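/- arXiv:1805.12377 — 5 statements merged into one kernel-verified Lean document; each statement's English description precedes it below -/
import Mathlib

section
/- Let (Ω,F,ℙ) be a probability space, G ⊆ F a σ-algebra, d : Ω → ℝ an F-measurable function with d(Ω) ⊆ [0,1), and let κ : Ω × B([0,1)) → [0,1] be a regular conditional probability kernel for the conditional law of d given G. Let (Ω̄,F̄,ℙ̄) := (Ω × (0,1], F ⊗ B((0,1]), ℙ ⊗ λ), where λ is Lebesgue measure on (0,1]. With the convention [0,0) = ∅, define H : Ω̄ → [0,1] by H(ω,s) := κ[ω,[0,d(ω))] + s·κ[ω,{d(ω)}] and d⁰ : Ω × [0,1] → [0,1] by d⁰(ω,h) := inf{ x ∈ [0,1] : κ[ω,[0,x]] ≥ h }. Then: (1) H is F̄-measurable, independent of the σ-algebra G ⊗ {∅,(0,1]}, and uniformly distributed on [0,1]; (2) d⁰ is (G ⊗ B([0,1]))/B([0,1])-measurable; (3) there exists a set N ∈ F with ℙ(N) = 0 such that for all (ω,s) ∈ (Ω∖N) × (0,1] one has d⁰(ω,H(ω,s)) = d(ω). -/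
open MeasureTheory ProbabilityTheory Filter Set
open scoped ENNReal NNReal Topology

noncomputable section

lemma pit_point (ν : Measure ℝ) [IsProbabilityMeasure ν] (h1 : ν (Ico 0 1) = 1)
    (u : ℝ) (hu0 : 0 < u) (hu1 : u ≤ 1) :
    ∃ c : ℝ, ν.real (Iio c) ≤ u ∧ u ≤ ν.real (Iic c) ∧ ∀ x < c, ν.real (Iic x) < u := by
  have hneg : ν (Iio 0) = 0 := by
    have : ν (Ico 0 1)ᶜ = 0 := (prob_compl_eq_zero_iff measurableSet_Ico).2 h1
    refine measure_mono_null ?_ this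
    intro x hx hx'
    exact absurd hx'.1 (not_le.2 hx)
  set S : Set ℝ := {x | u ≤ cdf ν x} with hS
  have hne : S.Nonempty := by
    refine ⟨1, ?_⟩
    simp only [hS, mem_ofPred_eq, cdf_eq_real]
    have : ν (Iic 1) = 1 := le_antisymm prob_le_one (h1 ▸ measure_mono (fun x hx => hx.2.le))
    simpa [measureReal_def, this] using hu1
  have hbdd : BddBelow S := by
    refine ⟨0, fun x hx => ?_⟩
    by_contra hlt
    push Not at hlt
    simp only [hS, mem_ofPred_eq, cdf_eq_real] at hx
    have : ν (Iic x) = 0 := measure_mono_null (fun y (hy : y ≤ x) => lt_of_le_of_lt hy hlt) hneg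
    simp [measureReal_def, this] at hx
    linarith
  have hlt : ∀ x < sInf S, ν.real (Iic x) < u := by
    intro x hx
    have := notMem_of_lt_csInf hx hbdd
    simpa [hS, cdf_eq_real] using this
  refine ⟨sInf S, ?_, ?_, hlt⟩
  · obtain ⟨v, hv1, hv2, hv3⟩ := exists_seq_strictMono_tendsto (sInf S)
    have hU : Iio (sInf S) = ⋃ n, Iic (v n) := by
      ext y
      simp only [mem_Iio, mem_iUnion, mem_Iic]
      constructor
      · intro hy
        obtain ⟨n, hn⟩ := (hv3.eventually_const_lt hy).exists
        exact ⟨n, hn.le⟩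
      · rintro ⟨n, hn⟩
        exact hn.trans_lt (hv2 n)
    have hmono : Monotone fun n => Iic (v n) := fun a b hab => Iic_subset_Iic.2 (hv1.monotone hab)
    have ht := tendsto_measure_iUnion_atTop (μ := ν) hmono
    rw [← hU] at ht
    have ht' := (ENNReal.tendsto_toReal (measure_ne_top ν _)).comp ht
    exact le_of_tendsto ht' (Eventually.of_forall fun n => (hlt _ (hv2 n)).le)
  · have hc := (cdf ν).right_continuous (sInf S)
    have hmem : ∀ x ∈ Ioi (sInf S), u ≤ cdf ν x := by
      intro x hx
      obtain ⟨y, hy, hyx⟩ := exists_lt_of_csInf_lt hne hx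
      exact le_trans hy ((cdf ν).mono hyx.le)
    have hc' : Tendsto (cdf ν) (𝓝[>] (sInf S)) (𝓝 (cdf ν (sInf S))) :=
      hc.mono_left (nhdsWithin_mono _ Ioi_subset_Ici_self)
    have := ge_of_tendsto hc' (eventually_nhdsWithin_of_forall hmem)
    simpa [cdf_eq_real] using this

lemma meas_Ico {Ω' : Type*} [MeasurableSpace Ω'] (κ : Kernel Ω' ℝ) [IsMarkovKernel κ] :
    Measurable fun p : Ω' × ℝ => κ p.1 (Ico 0 p.2) := by
  have := Kernel.measurable_kernel_prodMk_left (κ := κ.comap (Prod.fst : Ω' × ℝ → Ω') measurable_fst)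
    (t := {q : (Ω' × ℝ) × ℝ | 0 ≤ q.2 ∧ q.2 < q.1.2})
    ((measurableSet_le measurable_const measurable_snd).inter
      (measurableSet_lt measurable_snd measurable_fst.snd))
  exact this

lemma meas_Ioc {Ω' : Type*} [MeasurableSpace Ω'] (κ : Kernel Ω' ℝ) [IsMarkovKernel κ] (a : ℝ) :
    Measurable fun p : Ω' × ℝ => κ p.1 (Ioc a p.2) := by
  have := Kernel.measurable_kernel_prodMk_left (κ := κ.comap (Prod.fst : Ω' × ℝ → Ω') measurable_fst)
    (t := {q : (Ω' × ℝ) × ℝ | a < q.2 ∧ q.2 ≤ q.1.2})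
    ((measurableSet_lt measurable_const measurable_snd).inter
      (measurableSet_le measurable_snd measurable_fst.snd))
  exact this

lemma meas_singleton {Ω' : Type*} [MeasurableSpace Ω'] (κ : Kernel Ω' ℝ) [IsMarkovKernel κ] :
    Measurable fun p : Ω' × ℝ => κ p.1 {p.2} := by
  have := Kernel.measurable_kernel_prodMk_left (κ := κ.comap (Prod.fst : Ω' × ℝ → Ω') measurable_fst)
    (t := {q : (Ω' × ℝ) × ℝ | q.2 = q.1.2})
    (measurableSet_eq_fun measurable_snd measurable_fst.snd)
  exact this

lemma meas_Hk {Ω' : Type*} [MeasurableSpace Ω'] (κ : Kernel Ω' ℝ) [IsMarkovKernel κ] :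
    Measurable fun p : (Ω' × ℝ) × ℝ =>
      (κ p.1.1 (Ico 0 p.1.2)).toReal + p.2 * (κ p.1.1 {p.1.2}).toReal := by
  have hfst : Measurable (Prod.fst : (Ω' × ℝ) × ℝ → Ω' × ℝ) := measurable_fst
  have h1 := (meas_Ico κ).ennreal_toReal.comp hfst
  have h2 := (meas_singleton κ).ennreal_toReal.comp hfst
  exact h1.add (measurable_snd.mul h2)

lemma meas_pit (ν : Measure ℝ) [IsProbabilityMeasure ν] :
    Measurable fun p : ℝ × ℝ => (ν (Ico 0 p.1)).toReal + p.2 * (ν {p.1}).toReal := by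
  have := (meas_Hk (Kernel.const Unit ν)).comp
    (show Measurable fun p : ℝ × ℝ => (((), p.1), p.2) by fun_prop)
  simpa [Function.comp_def] using this

instance : IsProbabilityMeasure (volume.restrict (Ioc (0 : ℝ) 1)) := ⟨by simp⟩
instance : IsProbabilityMeasure (volume.restrict (Icc (0 : ℝ) 1)) := ⟨by simp⟩

lemma real_Ico_eq (ν : Measure ℝ) [IsProbabilityMeasure ν] (h1 : ν (Ico 0 1) = 1) (x : ℝ) :
    (ν (Ico 0 x)).toReal = ν.real (Iio x) := by
  have hneg : ν (Iio 0) = 0 := by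
    have : ν (Ico 0 1)ᶜ = 0 := (prob_compl_eq_zero_iff measurableSet_Ico).2 h1
    refine measure_mono_null ?_ this
    intro x hx hx'
    exact absurd hx'.1 (not_le.2 hx)
  rw [measureReal_def]
  congr 1
  apply le_antisymm (measure_mono (fun y hy => hy.2))
  calc ν (Iio x) ≤ ν (Iio 0 ∪ Ico 0 x) := measure_mono (fun y hy => by
        by_cases h : y < 0
        · exact Or.inl h
        · exact Or.inr ⟨not_lt.1 h, hy⟩)
    _ ≤ ν (Iio 0) + ν (Ico 0 x) := measure_union_le _ _
    _ = ν (Ico 0 x) := by rw [hneg, zero_add]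

lemma Iic_eq_add (ν : Measure ℝ) [IsProbabilityMeasure ν] (x : ℝ) :
    ν.real (Iic x) = ν.real (Iio x) + ν.real {x} := by
  rw [← measureReal_union (by simp) (measurableSet_singleton x)]
  congr 1
  ext y
  simp [le_iff_lt_or_eq, or_comm]

lemma pit_lt (ν : Measure ℝ) [IsProbabilityMeasure ν] (h1 : ν (Ico 0 1) = 1)
    (u : ℝ) (hu0 : 0 < u) (hu1 : u ≤ 1) :
    (ν.prod (volume.restrict (Ioc (0 : ℝ) 1)))
      {p : ℝ × ℝ | (ν (Ico 0 p.1)).toReal + p.2 * (ν {p.1}).toReal < u} = ENNReal.ofReal u := by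
  obtain ⟨c, hc1, hc2, hc3⟩ := pit_point ν h1 u hu0 hu1
  set l := volume.restrict (Ioc (0 : ℝ) 1) with hl
  set S : Set ℝ := {s | ν.real (Iio c) + s * ν.real {c} < u} with hS
  have hSm : MeasurableSet S := measurableSet_lt (by fun_prop) measurable_const
  have hae : ∀ᵐ p : ℝ × ℝ ∂(ν.prod l), p.2 ∈ Ioc (0 : ℝ) 1 :=
    Measure.quasiMeasurePreserving_snd.ae (ae_restrict_mem measurableSet_Ioc)
  have hset : {p : ℝ × ℝ | (ν (Ico 0 p.1)).toReal + p.2 * (ν {p.1}).toReal < u} =ᵐ[ν.prod l]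
      (Iio c ×ˢ univ ∪ {c} ×ˢ S : Set (ℝ × ℝ)) := by
    filter_upwards [hae] with p hp
    apply propext
    change (ν (Ico 0 p.1)).toReal + p.2 * (ν {p.1}).toReal < u ↔ p ∈ (Iio c ×ˢ univ ∪ {c} ×ˢ S : Set (ℝ × ℝ))
    obtain ⟨x, s⟩ := p
    rw [real_Ico_eq ν h1, ← measureReal_def]
    simp only [mem_union, mem_prod, mem_Iio, mem_univ, and_true, mem_singleton_iff, hS, mem_ofPred_eq]
    have hp0 : 0 ≤ ν.real {x} := measureReal_nonneg
    have hs0 : 0 < s := hp.1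
    have hs1 : s ≤ 1 := hp.2
    rcases lt_trichotomy x c with h | h | h
    · have := hc3 x h
      rw [Iic_eq_add] at this
      have : ν.real (Iio x) + s * ν.real {x} < u := by nlinarith
      simp [h, this]
    · subst h; simp
    · have h2 : ν.real (Iic c) ≤ ν.real (Iio x) :=
        measureReal_mono (fun y (hy : y ≤ c) => lt_of_le_of_lt hy h)
      have : ¬ (ν.real (Iio x) + s * ν.real {x} < u) := by nlinarith
      simp [this, h.not_gt, h.ne']
  rw [measure_congr hset, measure_union _ ((measurableSet_singleton c).prod hSm),
    Measure.prod_prod, Measure.prod_prod, measure_univ, mul_one]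
  swap
  · rw [Set.disjoint_left]
    rintro ⟨x, s⟩ h h'
    simp only [mem_prod, mem_Iio, mem_univ, and_true, mem_singleton_iff] at h h'
    exact absurd h'.1 h.ne
  rw [Iic_eq_add] at hc2
  rcases eq_or_lt_of_le (measureReal_nonneg (μ := ν) (s := {c})) with h0 | hpos
  · have h0' : ν {c} = 0 := by
      rw [measureReal_def] at h0
      exact ((ENNReal.toReal_eq_zero_iff _).1 h0.symm).resolve_right (measure_ne_top _ _)
    rw [h0', zero_mul, add_zero, ← ofReal_measureReal]
    congr 1
    linarith
  · have hSl : l S = ENNReal.ofReal ((u - ν.real (Iio c)) / ν.real {c}) := by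
      have hk0 : 0 ≤ (u - ν.real (Iio c)) / ν.real {c} := div_nonneg (by linarith) hpos.le
      have hk1 : (u - ν.real (Iio c)) / ν.real {c} ≤ 1 := by
        rw [div_le_one hpos]; linarith
      rw [hl, Measure.restrict_apply hSm]
      have : S ∩ Ioc 0 1 = Ioo 0 ((u - ν.real (Iio c)) / ν.real {c}) := by
        ext s
        simp only [hS, mem_inter_iff, mem_ofPred_eq, mem_Ioc, mem_Ioo, lt_div_iff₀ hpos]
        constructor
        · rintro ⟨a, b, _⟩
          exact ⟨b, by linarith⟩
        · rintro ⟨a, b⟩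
          refine ⟨by linarith, a, ?_⟩
          have : s < (u - ν.real (Iio c)) / ν.real {c} := by rwa [lt_div_iff₀ hpos]
          linarith
      rw [this, Real.volume_Ioo, sub_zero]
    rw [hSl, ← ofReal_measureReal, ← ofReal_measureReal, ← ENNReal.ofReal_mul hpos.le,
      mul_div_cancel₀ _ hpos.ne', ← ENNReal.ofReal_add measureReal_nonneg (by linarith)]
    congr 1
    ring

lemma pit (ν : Measure ℝ) [IsProbabilityMeasure ν] (h1 : ν (Ico 0 1) = 1) :
    (ν.prod (volume.restrict (Ioc (0 : ℝ) 1))).map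
      (fun p : ℝ × ℝ => (ν (Ico 0 p.1)).toReal + p.2 * (ν {p.1}).toReal) =
    volume.restrict (Icc (0 : ℝ) 1) := by
  have hm := meas_pit ν
  set l := volume.restrict (Ioc (0 : ℝ) 1) with hl
  have : IsProbabilityMeasure ((ν.prod l).map
      (fun p : ℝ × ℝ => (ν (Ico 0 p.1)).toReal + p.2 * (ν {p.1}).toReal)) :=
    Measure.isProbabilityMeasure_map hm.aemeasurable
  have hae : ∀ᵐ p : ℝ × ℝ ∂(ν.prod l), p.2 ∈ Ioc (0 : ℝ) 1 :=
    Measure.quasiMeasurePreserving_snd.ae (ae_restrict_mem measurableSet_Ioc)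
  apply Measure.ext_of_Ici
  intro u
  rw [← compl_Iio, prob_compl_eq_one_sub measurableSet_Iio, prob_compl_eq_one_sub measurableSet_Iio]
  congr 1
  rw [Measure.map_apply hm measurableSet_Iio, Measure.restrict_apply measurableSet_Iio]
  change (ν.prod l) {p : ℝ × ℝ | (ν (Ico 0 p.1)).toReal + p.2 * (ν {p.1}).toReal < u} = _
  rcases le_or_gt u 0 with h | h
  · have e : Iio u ∩ Icc (0:ℝ) 1 = ∅ := by
      ext x; simp only [mem_inter_iff, mem_Iio, mem_Icc, mem_empty_iff_false, iff_false]
      rintro ⟨a, b, _⟩; linarith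
    rw [e, measure_empty, measure_eq_zero_iff_ae_notMem]
    filter_upwards [hae] with p hp hlt
    have hlt' : (ν (Ico 0 p.1)).toReal + p.2 * (ν {p.1}).toReal < u := hlt
    have a1 : 0 ≤ (ν (Ico 0 p.1)).toReal := ENNReal.toReal_nonneg
    have a2 : 0 ≤ (ν {p.1}).toReal := ENNReal.toReal_nonneg
    nlinarith [hp.1, mul_nonneg hp.1.le a2]
  rcases le_or_gt u 1 with h' | h'
  · rw [pit_lt ν h1 u h h']
    have e : Iio u ∩ Icc (0:ℝ) 1 = Ico 0 u := by
      ext x; simp only [mem_inter_iff, mem_Iio, mem_Icc, mem_Ico]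
      constructor
      · rintro ⟨a, b, _⟩; exact ⟨b, a⟩
      · rintro ⟨a, b⟩; exact ⟨b, a, by linarith⟩
    rw [e, Real.volume_Ico, sub_zero]
  · have e : Iio u ∩ Icc (0:ℝ) 1 = Icc 0 1 := by
      ext x; simp only [mem_inter_iff, mem_Iio, mem_Icc]
      constructor
      · rintro ⟨a, b⟩; exact b
      · rintro ⟨a, b⟩; exact ⟨by linarith, a, b⟩
    rw [e, Real.volume_Icc, sub_zero, ENNReal.ofReal_one]
    have : ∀ᵐ p ∂(ν.prod l), p ∈ {p : ℝ × ℝ | (ν (Ico 0 p.1)).toReal + p.2 * (ν {p.1}).toReal < u} := by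
      filter_upwards [hae] with p hp
      change (ν (Ico 0 p.1)).toReal + p.2 * (ν {p.1}).toReal < u
      rw [real_Ico_eq ν h1, ← measureReal_def]
      have a1 : ν.real (Iic p.1) ≤ 1 := measureReal_le_one
      rw [Iic_eq_add] at a1
      have a2 : 0 ≤ ν.real {p.1} := measureReal_nonneg
      nlinarith [hp.2]
    exact (mem_ae_iff_prob_eq_one (hm measurableSet_Iio)).1 this

lemma gap_null (ν : Measure ℝ) (q : ℝ) :
    ν {y | q < y ∧ y < 1 ∧ ν (Ioc q y) = 0} = 0 := by
  set T := {y | q < y ∧ y < 1 ∧ ν (Ioc q y) = 0} with hT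
  rcases T.eq_empty_or_nonempty with h | h
  · rw [h, measure_empty]
  have hb : BddAbove T := ⟨1, fun y hy => hy.2.1.le⟩
  by_cases hmem : sSup T ∈ T
  · refine measure_mono_null ?_ hmem.2.2
    intro y hy
    exact ⟨hy.1, le_csSup hb hy⟩
  · obtain ⟨v, -, -, hv, hvT⟩ := (isLUB_csSup h hb).exists_seq_monotone_tendsto h
    refine measure_mono_null (t := ⋃ n, Ioc q (v n)) (fun y hy => ?_)
      (measure_iUnion_null fun n => (hvT n).2.2)
    have hlt : y < sSup T := lt_of_le_of_ne (le_csSup hb hy) (fun e => hmem (e ▸ hy))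
    obtain ⟨n, hn⟩ := (hv.eventually_const_lt hlt).exists
    exact mem_iUnion.2 ⟨n, hy.1, hn.le⟩

lemma d0_meas {Ω' : Type*} [MeasurableSpace Ω'] (κ : Kernel Ω' ℝ) [IsMarkovKernel κ]
    (d0 : Ω' × ℝ → ℝ)
    (hd0 : ∀ ω h, d0 (ω, h) =
      sInf {x : ℝ | x ∈ Set.Icc (0 : ℝ) 1 ∧ h ≤ (κ ω (Set.Icc 0 x)).toReal}) :
    Measurable d0 := by
  have hF : ∀ x : ℝ, Measurable fun p : Ω' × ℝ => (κ p.1 (Icc 0 x)).toReal := fun x =>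
    (Measurable.ennreal_toReal (κ.measurable_coe measurableSet_Icc)).comp measurable_fst
  have hbdd : ∀ ω h, BddBelow {x : ℝ | x ∈ Set.Icc (0 : ℝ) 1 ∧ h ≤ (κ ω (Set.Icc 0 x)).toReal} :=
    fun ω h => ⟨0, fun x hx => hx.1.1⟩
  have hmono : ∀ ω, ∀ x y : ℝ, x ≤ y → (κ ω (Icc 0 x)).toReal ≤ (κ ω (Icc 0 y)).toReal :=
    fun ω x y hxy => ENNReal.toReal_mono (measure_ne_top _ _) (measure_mono (Icc_subset_Icc_right hxy))
  apply measurable_of_Iio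
  intro a
  have : d0 ⁻¹' Iio a = ({p | (κ p.1 (Icc 0 1)).toReal < p.2} ∩ {_p | 0 < a}) ∪
      ({p | p.2 ≤ (κ p.1 (Icc 0 1)).toReal} ∩ {_p | 1 < a}) ∪
      ⋃ q : ℚ, {p | p.2 ≤ (κ p.1 (Icc 0 (q : ℝ))).toReal} ∩ {_p | (q : ℝ) < a ∧ 0 ≤ (q:ℝ) ∧ (q:ℝ) ≤ 1} := by
    ext ⟨ω, h⟩
    simp only [mem_preimage, mem_Iio, mem_union, mem_inter_iff, mem_ofPred_eq, mem_iUnion, hd0]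
    by_cases he : h ≤ (κ ω (Icc 0 1)).toReal
    · have hne : {x : ℝ | x ∈ Set.Icc (0 : ℝ) 1 ∧ h ≤ (κ ω (Set.Icc 0 x)).toReal}.Nonempty :=
        ⟨1, ⟨zero_le_one, le_rfl⟩, he⟩
      rw [csInf_lt_iff (hbdd ω h) hne]
      constructor
      · rintro ⟨x, ⟨⟨hx0, hx1⟩, hx⟩, hxa⟩
        rcases eq_or_lt_of_le hx1 with e | hx1
        · left; right; exact ⟨he, e ▸ hxa⟩
        · obtain ⟨q, hq1, hq2⟩ := exists_rat_btwn (lt_min hxa hx1)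
          right
          exact ⟨q, hx.trans (hmono ω _ _ hq1.le), hq2.trans_le (min_le_left _ _),
            hx0.trans hq1.le, (hq2.trans_le (min_le_right _ _)).le⟩
      · rintro ((⟨h1, -⟩ | ⟨-, h2⟩) | ⟨q, h1, h2, h3, h4⟩)
        · exact absurd he (not_le.2 h1)
        · exact ⟨1, ⟨⟨zero_le_one, le_rfl⟩, he⟩, h2⟩
        · exact ⟨q, ⟨⟨h3, h4⟩, h1⟩, h2⟩
    · have hempty : {x : ℝ | x ∈ Set.Icc (0 : ℝ) 1 ∧ h ≤ (κ ω (Set.Icc 0 x)).toReal} = ∅ := by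
        ext x
        simp only [mem_ofPred_eq, mem_empty_iff_false, iff_false]
        rintro ⟨hx, hx'⟩
        exact he (hx'.trans (hmono ω _ _ hx.2))
      rw [hempty, Real.sInf_empty]
      constructor
      · intro ha; left; left; exact ⟨not_le.1 he, ha⟩
      · rintro ((⟨h1, h2⟩ | ⟨h1, -⟩) | ⟨q, h1, h2, h3, h4⟩)
        · exact h2
        · exact absurd h1 he
        · exact h3.trans_lt h2
  rw [this]
  refine ((measurableSet_lt (hF 1) measurable_snd).inter (.const _)).union
    ((measurableSet_le measurable_snd (hF 1)).inter (.const _)) |>.union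
    (MeasurableSet.iUnion fun q => (measurableSet_le measurable_snd (hF q)).inter (.const _))

lemma d0_eq (ν : Measure ℝ) [IsProbabilityMeasure ν] (y s : ℝ)
    (hy : y ∈ Ico (0:ℝ) 1) (hs : s ∈ Ioc (0:ℝ) 1)
    (hgap : ∀ q : ℚ, (q : ℝ) < y → ν (Ioc (q : ℝ) y) ≠ 0) :
    sInf {x : ℝ | x ∈ Set.Icc (0 : ℝ) 1 ∧
      (ν (Ico 0 y)).toReal + s * (ν {y}).toReal ≤ (ν (Set.Icc 0 x)).toReal} = y := by
  have hsplit : ∀ x, 0 ≤ x → ν.real (Icc 0 x) = ν.real (Ico 0 x) + ν.real {x} := by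
    intro x hx
    rw [← measureReal_union (by simp) (measurableSet_singleton x), Ico_union_right hx]
  simp only [← measureReal_def]
  have hp0 : 0 ≤ ν.real {y} := measureReal_nonneg
  refine IsLeast.csInf_eq ⟨⟨⟨hy.1, hy.2.le⟩, ?_⟩, ?_⟩
  · rw [hsplit y hy.1]
    nlinarith [hs.2]
  · rintro x ⟨⟨hx0, hx1⟩, hx⟩
    by_contra hlt
    push Not at hlt
    obtain ⟨q, hq1, hq2⟩ := exists_rat_btwn hlt
    have hle : ν.real (Icc 0 x) + ν.real (Ioo x y) = ν.real (Ico 0 y) := by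
      rw [← measureReal_union _ measurableSet_Ioo]
      · congr 1
        ext z
        simp only [mem_union, mem_Icc, mem_Ioo, mem_Ico]
        constructor
        · rintro (⟨a, b⟩ | ⟨a, b⟩)
          · exact ⟨a, by linarith⟩
          · exact ⟨by linarith, b⟩
        · rintro ⟨a, b⟩
          rcases le_or_gt z x with h | h
          · exact Or.inl ⟨a, h⟩
          · exact Or.inr ⟨h, b⟩
      · rw [Set.disjoint_left]
        rintro z ⟨_, a⟩ ⟨b, _⟩
        linarith
    have hpos : 0 < ν.real (Ioc (q:ℝ) y) := ENNReal.toReal_pos (hgap q hq2) (measure_ne_top _ _)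
    have hle2 : ν.real (Ioc (q:ℝ) y) ≤ ν.real (Ioo x y) + ν.real {y} := by
      refine (measureReal_mono (fun z hz => ?_)).trans (measureReal_union_le (Ioo x y) {y})
      rcases eq_or_lt_of_le hz.2 with h | h
      · exact Or.inr h
      · exact Or.inl ⟨hq1.trans hz.1, h⟩
    have h3 : 0 ≤ ν.real (Ioo x y) := measureReal_nonneg
    have h4 : 0 ≤ s * ν.real {y} := mul_nonneg hs.1.le hp0
    have h5 : s * ν.real {y} = 0 := by linarith
    have h6 : ν.real {y} = 0 := (mul_eq_zero.1 h5).resolve_left hs.1.ne'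
    linarith

lemma general {Ω Ω' : Type*} [MeasurableSpace Ω] [MeasurableSpace Ω']
    (μ : Measure Ω) [IsProbabilityMeasure μ] (π : Ω → Ω') (hπ : Measurable π)
    (d : Ω → ℝ) (hd : Measurable d) (hd01 : ∀ ω, d ω ∈ Set.Ico (0 : ℝ) 1)
    (κ : Kernel Ω' ℝ) [IsMarkovKernel κ]
    (hκ : ∀ A : Set Ω', MeasurableSet A → ∀ B : Set ℝ, MeasurableSet B →
      μ (π ⁻¹' A ∩ d ⁻¹' B) = ∫⁻ ω in π ⁻¹' A, κ (π ω) B ∂μ)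
    (H : Ω × ℝ → ℝ)
    (hH : ∀ ω s, H (ω, s) = (κ (π ω) (Set.Ico 0 (d ω))).toReal + s * (κ (π ω) {d ω}).toReal) :
    Measurable H ∧
    IndepFun H (fun p => π p.1) (μ.prod (volume.restrict (Set.Ioc (0 : ℝ) 1))) ∧
    Measure.map H (μ.prod (volume.restrict (Set.Ioc (0 : ℝ) 1))) =
      volume.restrict (Set.Icc (0 : ℝ) 1) ∧
    ∀ᵐ ω ∂μ, ∀ q : ℚ, (q : ℝ) < d ω → κ (π ω) (Ioc (q : ℝ) (d ω)) ≠ 0 := by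
  set l := volume.restrict (Ioc (0 : ℝ) 1) with hl
  have hHk := meas_Hk κ
  set Hk : (Ω' × ℝ) × ℝ → ℝ := fun p =>
    (κ p.1.1 (Ico 0 p.1.2)).toReal + p.2 * (κ p.1.1 {p.1.2}).toReal with hHkdef
  have hHm : Measurable H := by
    have : H = fun p => Hk ((π p.1, d p.1), p.2) := by
      ext ⟨ω, s⟩; exact hH ω s
    rw [this]
    fun_prop
  have hpd : Measurable fun ω => (π ω, d ω) := hπ.prodMk hd
  have : IsProbabilityMeasure (μ.map π) := Measure.isProbabilityMeasure_map hπ.aemeasurable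
  have : IsProbabilityMeasure (μ.map fun ω => (π ω, d ω)) :=
    Measure.isProbabilityMeasure_map hpd.aemeasurable
  have hρ : μ.map (fun ω => (π ω, d ω)) = (μ.map π) ⊗ₘ κ := by
    apply Measure.ext_prod
    intro A B hA hB
    rw [Measure.map_apply hpd (hA.prod hB), Measure.compProd_apply_prod hA hB,
      setLIntegral_map hA (κ.measurable_coe hB) hπ, ← hκ A hA B hB]
    rfl
  have hsupp : ∀ᵐ w ∂(μ.map π), κ w (Ico 0 1) = 1 := by
    have h1 : ∀ᵐ z ∂(μ.map (fun ω => (π ω, d ω))), z.2 ∈ Ico (0:ℝ) 1 := by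
      rw [ae_map_iff hpd.aemeasurable (measurable_snd measurableSet_Ico)]
      exact Eventually.of_forall hd01
    rw [hρ] at h1
    filter_upwards [Measure.ae_ae_of_ae_compProd h1] with w hw
    exact (mem_ae_iff_prob_eq_one measurableSet_Ico).1 hw
  have hjoint : (μ.prod l).map (fun p => (π p.1, H p)) =
      (μ.map π).prod (volume.restrict (Icc (0:ℝ) 1)) := by
    symm
    apply Measure.prod_eq
    intro A B hA hB
    have hpm : Measurable fun p : Ω × ℝ => (π p.1, H p) := by fun_prop
    rw [Measure.map_apply hpm (hA.prod hB), Measure.prod_apply (hpm (hA.prod hB))]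
    set f : Ω' × ℝ → ℝ≥0∞ := fun z => l (Prod.mk z ⁻¹' {p | p.1.1 ∈ A ∧ Hk p ∈ B}) with hf
    have hSm : MeasurableSet {p : (Ω' × ℝ) × ℝ | p.1.1 ∈ A ∧ Hk p ∈ B} :=
      (measurable_fst.fst hA).inter (hHk hB)
    have hfm : Measurable f := measurable_measure_prodMk_left hSm
    have e1 : ∀ ω, l (Prod.mk ω ⁻¹' ((fun p : Ω × ℝ => (π p.1, H p)) ⁻¹' A ×ˢ B)) = f (π ω, d ω) := by
      intro ω
      simp only [hf]
      congr 1
      ext s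
      simp [hH, hHkdef]
    simp_rw [e1]
    rw [← lintegral_map hfm hpd, hρ, Measure.lintegral_compProd hfm]
    have e2 : ∀ᵐ w ∂(μ.map π), ∫⁻ x, f (w, x) ∂(κ w) =
        A.indicator (fun _ => volume.restrict (Icc (0:ℝ) 1) B) w := by
      filter_upwards [hsupp] with w hw
      by_cases hwA : w ∈ A
      · rw [indicator_of_mem hwA, ← pit (κ w) hw, Measure.map_apply (meas_pit _) hB,
          Measure.prod_apply (meas_pit _ hB)]
        refine lintegral_congr fun x => ?_
        simp only [hf]
        congr 1
        ext s
        simp [hwA, hHkdef]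
      · rw [indicator_of_notMem hwA]
        simp [hf, hwA]
    rw [lintegral_congr_ae e2, lintegral_indicator_const hA, mul_comm]
  have hmapπ : (μ.prod l).map (fun p => π p.1) = μ.map π := by
    have := congrArg (Measure.map Prod.fst) hjoint
    rw [Measure.map_map measurable_fst (by fun_prop)] at this
    simpa [Function.comp_def, Measure.map_fst_prod] using this
  have hmapH : (μ.prod l).map H = volume.restrict (Icc (0:ℝ) 1) := by
    have := congrArg (Measure.map Prod.snd) hjoint
    rw [Measure.map_map measurable_snd (by fun_prop)] at this
    simpa [Function.comp_def, Measure.map_snd_prod] using this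
  refine ⟨hHm, ?_, hmapH, ?_⟩
  · apply IndepFun.symm
    rw [indepFun_iff_map_prod_eq_prod_map_map (by fun_prop) hHm.aemeasurable, hjoint, hmapπ, hmapH]
  · have hgood : ∀ᵐ z ∂((μ.map π) ⊗ₘ κ), ∀ q : ℚ, (q:ℝ) < z.2 → κ z.1 (Ioc (q:ℝ) z.2) ≠ 0 := by
      rw [ae_all_iff]
      intro q
      apply Measure.ae_compProd_of_ae_ae
      · have : {x : Ω' × ℝ | (q:ℝ) < x.2 → κ x.1 (Ioc (q:ℝ) x.2) ≠ 0} =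
            ({x | (q:ℝ) < x.2} ∩ {x | κ x.1 (Ioc (q:ℝ) x.2) = 0})ᶜ := by
          ext x; simp
        rw [this]
        exact ((measurableSet_lt measurable_const measurable_snd).inter
          (meas_Ioc κ q (measurableSet_singleton 0))).compl
      · filter_upwards [hsupp] with w hw
        have h1 : ∀ᵐ x ∂(κ w), x ∈ Ico (0:ℝ) 1 := (mem_ae_iff_prob_eq_one measurableSet_Ico).2 hw
        filter_upwards [h1, measure_eq_zero_iff_ae_notMem.1 (gap_null (κ w) q)] with x hx hx' hq h0
        exact hx' ⟨hq, hx.2, h0⟩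
    rw [← hρ] at hgood
    exact ae_of_ae_map hpd.aemeasurable hgood

/-- Factorization of a `[0,1)`-valued random variable `d` along a regular version `κ` of its
conditional distribution given `G`: on `Ω̄ = Ω × (0,1]` with `ℙ̄ = ℙ ⊗ λ`, the random
variable `H(ω,s) = κ[ω,[0,d(ω))] + s κ[ω,{d(ω)}]` is uniform on `[0,1]` and independent of
`G ⊗ {∅,(0,1]}`, the generalized inverse `d⁰(ω,h) = inf{x ∈ [0,1] : κ[ω,[0,x]] ≥ h}` is
`G ⊗ B([0,1])`-measurable, and `d⁰(ω,H(ω,s)) = d(ω)` outside a `ℙ`-null set. -/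
theorem factorization_along_regular_conditional_probability
    {Ω : Type*} (G : MeasurableSpace Ω) {m0 : MeasurableSpace Ω}
    (μ : Measure Ω) [IsProbabilityMeasure μ] (hG : G ≤ m0)
    (d : Ω → ℝ) (hd : Measurable d) (hd01 : ∀ ω, d ω ∈ Set.Ico (0 : ℝ) 1)
    -- `κ` is a regular conditional probability kernel for `L(d | G)`
    (κ : Ω → Measure ℝ)
    (hκprob : ∀ ω, IsProbabilityMeasure (κ ω))
    (hκmeas : ∀ B : Set ℝ, MeasurableSet B → Measurable[G] fun ω => (κ ω B).toReal)
    (hκcond : ∀ B : Set ℝ, MeasurableSet B →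
      (fun ω => (κ ω B).toReal) =ᵐ[μ] μ[(d ⁻¹' B).indicator (fun _ => (1 : ℝ)) | G])
    -- the factorizing random variables
    (H : Ω × ℝ → ℝ)
    (hH : ∀ ω s, H (ω, s) = (κ ω (Set.Ico 0 (d ω))).toReal + s * (κ ω {d ω}).toReal)
    (d0 : Ω × ℝ → ℝ)
    (hd0 : ∀ ω h, d0 (ω, h) =
      sInf {x : ℝ | x ∈ Set.Icc (0 : ℝ) 1 ∧ h ≤ (κ ω (Set.Icc 0 x)).toReal}) :
    -- (1) `H` is measurable, independent of `G ⊗ {∅,(0,1]}` and uniformly distributed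
    Measurable H ∧
    Indep (MeasurableSpace.comap H inferInstance) (MeasurableSpace.comap Prod.fst G)
      (μ.prod (volume.restrict (Set.Ioc (0 : ℝ) 1))) ∧
    Measure.map H (μ.prod (volume.restrict (Set.Ioc (0 : ℝ) 1))) =
      volume.restrict (Set.Icc (0 : ℝ) 1) ∧
    -- (2) `d⁰` is `G ⊗ B([0,1])`-measurable
    Measurable[MeasurableSpace.prod G (inferInstance : MeasurableSpace ℝ)] d0 ∧
    -- (3) `d⁰(ω, H(ω,s)) = d(ω)` off a null set
    ∃ Nset : Set Ω, MeasurableSet Nset ∧ μ Nset = 0 ∧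
      ∀ ω ∉ Nset, ∀ s ∈ Set.Ioc (0 : ℝ) 1, d0 (ω, H (ω, s)) = d ω := by
  have hfin : ∀ ω B, κ ω B ≠ ∞ := fun ω B => measure_ne_top _ _
  have hof : ∀ B, (fun ω => κ ω B) = fun ω => ENNReal.ofReal (κ ω B).toReal := fun B => by
    ext ω; rw [ENNReal.ofReal_toReal (hfin ω B)]
  have hκm : @Measurable Ω (Measure ℝ) G _ κ :=
    @Measure.measurable_of_measurable_coe ℝ Ω _ G κ fun B hB => by
      rw [hof B]
      exact ENNReal.measurable_ofReal.comp (hκmeas B hB)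
  let K : @Kernel Ω ℝ G _ := @Kernel.mk Ω ℝ G _ κ hκm
  have hK : @IsMarkovKernel Ω ℝ G _ K := @IsMarkovKernel.mk Ω ℝ G _ K hκprob
  have hKeq : ∀ A : Set Ω, MeasurableSet[G] A → ∀ B : Set ℝ, MeasurableSet B →
      μ (A ∩ d ⁻¹' B) = ∫⁻ ω in A, κ ω B ∂μ := by
    intro A hA B hB
    have hA0 : MeasurableSet A := hG A hA
    have hint : Integrable ((d ⁻¹' B).indicator (fun _ => (1 : ℝ))) μ :=
      (integrable_const 1).indicator (hd hB)
    have hint2 : Integrable (fun ω => (κ ω B).toReal) μ :=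
      integrable_condExp.congr (hκcond B hB).symm
    have h1 := setIntegral_condExp hG hint hA
    rw [← setIntegral_congr_ae hA0 ((hκcond B hB).mono fun x hx _ => hx)] at h1
    rw [setIntegral_indicator (hd hB), setIntegral_const, smul_eq_mul, mul_one] at h1
    rw [hof B, ← ofReal_integral_eq_lintegral_ofReal hint2.integrableOn
      (Eventually.of_forall fun _ => ENNReal.toReal_nonneg), h1, ofReal_measureReal]
  obtain ⟨h1, h2, h3, h4⟩ := @general Ω Ω m0 G μ _ id (measurable_id'' hG) d hd hd01 K hK hKeq H hH
  refine ⟨h1, h2, h3, @d0_meas Ω G K hK d0 hd0, ?_⟩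
  obtain ⟨N, hsub, hN, hN0⟩ := exists_measurable_superset_of_null (ae_iff.1 h4)
  refine ⟨N, hN, hN0, fun ω hω s hs => ?_⟩
  have hg : ∀ q : ℚ, (q : ℝ) < d ω → κ ω (Ioc (q : ℝ) (d ω)) ≠ 0 := by
    by_contra hc
    exact hω (hsub hc)
  have := hκprob ω
  rw [hd0, hH]
  exact d0_eq (κ ω) (d ω) s (hd01 ω) hs hg
end
end

section
/- Let (Ω,F,ℙ) be a probability space, G ⊆ F a σ-algebra, X a separable Banach space, and d : Ω → X an F-measurable random variable. Let (Ω̄,F̄,ℙ̄) := (Ω × (0,1], F ⊗ B((0,1]), ℙ ⊗ λ), where λ is Lebesgue measure on (0,1]. Then there exist maps H : Ω̄ → [0,1] and d⁰ : Ω × [0,1] → X such that: (1) H is a uniformly-[0,1] distributed random variable on (Ω̄,F̄,ℙ̄) that is independent of G ⊗ {∅,(0,1]}; (2) d⁰ is (G ⊗ B([0,1]))/B(X)-measurable; (3) there exists N ∈ F with ℙ(N) = 0 such that d(ω) = d⁰(ω,H(ω,s)) for all (ω,s) ∈ (Ω∖N) × (0,1]. -/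
open MeasureTheory ProbabilityTheory Filter Set
open scoped ENNReal NNReal Topology

noncomputable section

/-- Randomised distribution function. -/
def rdf (ν : Measure ℝ) (y s : ℝ) : ℝ :=
  ν.real (Iio y) + max 0 (min s 1) * (ν.real (Iic y) - ν.real (Iio y))

lemma real_Iio_le_Iic (ν : Measure ℝ) [IsProbabilityMeasure ν] (y : ℝ) :
    ν.real (Iio y) ≤ ν.real (Iic y) := measureReal_mono Iio_subset_Iic_self

lemma le_rdf (ν : Measure ℝ) [IsProbabilityMeasure ν] (y s : ℝ) :
    ν.real (Iio y) ≤ rdf ν y s := by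
  have h := real_Iio_le_Iic ν y
  have : 0 ≤ max 0 (min s 1) := le_max_left _ _
  unfold rdf
  nlinarith

lemma rdf_le (ν : Measure ℝ) [IsProbabilityMeasure ν] (y s : ℝ) :
    rdf ν y s ≤ ν.real (Iic y) := by
  have h := real_Iio_le_Iic ν y
  have : max 0 (min s 1) ≤ 1 := max_le (by norm_num) (min_le_right _ _)
  unfold rdf
  nlinarith

lemma rdf_mem (ν : Measure ℝ) [IsProbabilityMeasure ν] (y s : ℝ) :
    rdf ν y s ∈ Icc (0 : ℝ) 1 :=
  ⟨measureReal_nonneg.trans (le_rdf ν y s), (rdf_le ν y s).trans measureReal_le_one⟩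

lemma exists_quantile (ν : Measure ℝ) [IsProbabilityMeasure ν] (t : ℝ) (ht : 0 < t)
    (hne : {y | t ≤ ν.real (Iic y)}.Nonempty) :
    ∃ q, (∀ y < q, ν.real (Iic y) < t) ∧ t ≤ ν.real (Iic q) ∧ ν.real (Iio q) ≤ t := by
  simp only [← cdf_eq_real] at *
  have hbdd : BddBelow {y | t ≤ cdf ν y} := by
    obtain ⟨b, hb⟩ := ((tendsto_cdf_atBot ν).eventually_lt_const ht).exists
    refine ⟨b, fun y hy => ?_⟩
    by_contra! hlt
    exact absurd (lt_of_le_of_lt (monotone_cdf ν hlt.le) hb) (not_lt.mpr hy)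
  have h1 : ∀ y < sInf {y | t ≤ cdf ν y}, cdf ν y < t := fun y hy => by
    by_contra! h
    exact absurd (csInf_le hbdd h) (not_le.mpr hy)
  refine ⟨sInf {y | t ≤ cdf ν y}, h1, ?_, ?_⟩
  · have hc := (cdf ν).right_continuous (sInf {y | t ≤ cdf ν y})
    have hc' := hc.tendsto.mono_left (nhdsWithin_mono _ Ioi_subset_Ici_self)
    refine ge_of_tendsto hc' ?_
    filter_upwards [self_mem_nhdsWithin] with y hy
    obtain ⟨z, hz, hzy⟩ := exists_lt_of_csInf_lt hne hy
    exact le_trans hz (monotone_cdf ν hzy.le)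
  · have : ν (Iio (sInf {y | t ≤ cdf ν y})) ≤ ENNReal.ofReal t := by
      have hM := StieltjesFunction.measure_Iio (cdf ν) (tendsto_cdf_atBot ν)
        (sInf {y | t ≤ cdf ν y})
      rw [measure_cdf] at hM
      rw [hM]
      apply ENNReal.ofReal_le_ofReal
      rw [sub_zero]
      refine le_of_tendsto ((cdf ν).mono.tendsto_leftLim _) ?_
      filter_upwards [self_mem_nhdsWithin] with y hy using (h1 y hy).le
    rw [measureReal_def]
    exact ENNReal.toReal_le_of_le_ofReal ht.le this

lemma measurable_rdf (ν : Measure ℝ) [IsProbabilityMeasure ν] :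
    Measurable (fun p : ℝ × ℝ => rdf ν p.1 p.2) := by
  have h1 : Measurable (fun y => ν.real (Iio y)) :=
    Monotone.measurable fun a b h => measureReal_mono (Iio_subset_Iio h)
  have h2 : Measurable (fun y => ν.real (Iic y)) :=
    Monotone.measurable fun a b h => measureReal_mono (Iic_subset_Iic.2 h)
  unfold rdf
  have h1' := h1.comp ((measurable_fst : Measurable (Prod.fst : ℝ × ℝ → ℝ)))
  have h2' := h2.comp ((measurable_fst : Measurable (Prod.fst : ℝ × ℝ → ℝ)))
  exact h1'.add ((measurable_const.max (measurable_snd.min measurable_const)).mul (h2'.sub h1'))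

lemma rdf_lt (ν : Measure ℝ) [IsProbabilityMeasure ν] (t : ℝ) (ht0 : 0 < t) (ht1 : t ≤ 1) :
    (ν.prod (volume.restrict (Ioc (0 : ℝ) 1))) {p | rdf ν p.1 p.2 < t} = ENNReal.ofReal t := by
  rcases Set.eq_empty_or_nonempty {y | t ≤ ν.real (Iic y)} with he | hne
  · have hall : ∀ y, ν.real (Iic y) < t := by
      intro y
      by_contra! h
      have : y ∈ {y | t ≤ ν.real (Iic y)} := h
      simp [he] at this
    have h1 : (1 : ℝ) ≤ t := by
      refine le_of_tendsto (tendsto_cdf_atTop ν) (Eventually.of_forall fun y => ?_)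
      rw [cdf_eq_real]; exact (hall y).le
    have : t = 1 := le_antisymm ht1 h1
    have hu : {p : ℝ × ℝ | rdf ν p.1 p.2 < t} = univ := by
      ext p; simpa using (rdf_le ν p.1 p.2).trans_lt (hall p.1)
    rw [hu, this]; simp
  obtain ⟨q, hq1, hq2, hq3⟩ := exists_quantile ν t ht0 hne
  have hms : MeasurableSet {p : ℝ × ℝ | rdf ν p.1 p.2 < t} :=
    measurable_rdf ν measurableSet_Iio
  rw [Measure.prod_apply hms]
  set c := (volume.restrict (Ioc (0 : ℝ) 1)) {s | rdf ν q s < t} with hc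
  have hint : ∀ y, (volume.restrict (Ioc (0 : ℝ) 1)) (Prod.mk y ⁻¹' {p : ℝ × ℝ | rdf ν p.1 p.2 < t})
      = (Iio q).indicator 1 y + ({q} : Set ℝ).indicator (fun _ => c) y := by
    intro y
    rcases lt_trichotomy y q with h | h | h
    · have : Prod.mk y ⁻¹' {p : ℝ × ℝ | rdf ν p.1 p.2 < t} = univ := by
        ext s; simpa using (rdf_le ν y s).trans_lt (hq1 y h)
      rw [this]
      simp [h, h.ne]
    · subst h
      simp [hc]
    · have : Prod.mk y ⁻¹' {p : ℝ × ℝ | rdf ν p.1 p.2 < t} = ∅ := by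
        ext s
        have : ν.real (Iic q) ≤ ν.real (Iio y) := measureReal_mono (Iic_subset_Iio.2 h)
        simpa using (hq2.trans this).trans (le_rdf ν y s)
      rw [this]
      simp [h.le, h.ne']
  simp_rw [hint]
  rw [lintegral_add_left (by exact measurable_one.indicator measurableSet_Iio),
    lintegral_indicator_one measurableSet_Iio,
    lintegral_indicator_const (measurableSet_singleton q)]
  have hsplit : ν.real (Iic q) = ν.real (Iio q) + ν.real {q} := by
    rw [← measureReal_union (by simp) (measurableSet_singleton q)]
    congr 1
    ext x; simp [le_iff_lt_or_eq]
  have hcv : c * ν {q} = ENNReal.ofReal (t - ν.real (Iio q)) := by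
    rcases (measureReal_nonneg : 0 ≤ ν.real {q}).eq_or_lt with hp | hp
    · have h0 : ν {q} = 0 := by
        simpa [measureReal_def, ENNReal.toReal_eq_zero_iff] using hp.symm
      have : t - ν.real (Iio q) ≤ 0 := by linarith
      rw [h0, ENNReal.ofReal_of_nonpos this, mul_zero]
    · have hset : {s | rdf ν q s < t} ∩ Ioc 0 1 = Ioo 0 ((t - ν.real (Iio q)) / ν.real {q}) := by
        have ha : (t - ν.real (Iio q)) / ν.real {q} ≤ 1 := by
          rw [div_le_one hp]; linarith
        have key : ∀ s, s ∈ Ioc (0 : ℝ) 1 →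
            (rdf ν q s < t ↔ s < (t - ν.real (Iio q)) / ν.real {q}) := by
          intro s hs
          rw [lt_div_iff₀ hp, rdf, min_eq_left hs.2, max_eq_right hs.1.le, hsplit]
          constructor <;> intro h <;> linarith
        ext s
        constructor
        · rintro ⟨h1, h2⟩
          exact ⟨h2.1, (key s h2).1 h1⟩
        · rintro ⟨h1, h2⟩
          have hs : s ∈ Ioc (0 : ℝ) 1 := ⟨h1, (h2.trans_le ha).le⟩
          exact ⟨(key s hs).2 h2, hs⟩
      have hms2 : MeasurableSet {s | rdf ν q s < t} :=
        (measurable_rdf ν).comp measurable_prodMk_left measurableSet_Iio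
      rw [hc, Measure.restrict_apply hms2, hset, Real.volume_Ioo, sub_zero,
        ← ofReal_measureReal (μ := ν) (s := {q}), ← ENNReal.ofReal_mul
          (div_nonneg (by linarith) hp.le), div_mul_cancel₀ _ hp.ne']
  rw [hcv, ← ofReal_measureReal (μ := ν) (s := Iio q), ← ENNReal.ofReal_add measureReal_nonneg
    (by linarith)]
  congr 1; ring

lemma map_rdf (ν : Measure ℝ) [IsProbabilityMeasure ν] :
    (ν.prod (volume.restrict (Ioc (0 : ℝ) 1))).map (fun p => rdf ν p.1 p.2) =
      volume.restrict (Icc (0 : ℝ) 1) := by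
  have hm := measurable_rdf ν
  have : IsProbabilityMeasure ((ν.prod (volume.restrict (Ioc (0 : ℝ) 1))).map
    (fun p => rdf ν p.1 p.2)) := Measure.isProbabilityMeasure_map hm.aemeasurable
  refine Measure.ext_of_Ici _ _ fun t => ?_
  rw [← compl_Iio, prob_compl_eq_one_sub measurableSet_Iio,
    prob_compl_eq_one_sub measurableSet_Iio]
  congr 1
  rw [Measure.map_apply hm measurableSet_Iio, Measure.restrict_apply measurableSet_Iio]
  change _ = volume (Iio t ∩ Icc 0 1)
  rcases le_or_gt t 0 with h0 | h0
  · have e1 : (fun p : ℝ × ℝ => rdf ν p.1 p.2) ⁻¹' Iio t = ∅ := by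
      ext p; simpa using h0.trans (rdf_mem ν p.1 p.2).1
    have e2 : Iio t ∩ Icc 0 1 = ∅ := by
      ext p; simp; intro h1 h2; linarith
    rw [e1, e2]; simp
  rcases le_or_gt t 1 with h1 | h1
  · have e2 : Iio t ∩ Icc 0 1 = Ico 0 t := by
      ext p; simp only [mem_inter_iff, mem_Iio, mem_Icc, mem_Ico]
      constructor
      · rintro ⟨a, b, c⟩; exact ⟨b, a⟩
      · rintro ⟨a, b⟩; exact ⟨b, a, by linarith⟩
    rw [e2, Real.volume_Ico, sub_zero]
    exact rdf_lt ν t h0 h1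
  · have e1 : (fun p : ℝ × ℝ => rdf ν p.1 p.2) ⁻¹' Iio t = univ := by
      ext p; simpa using (rdf_mem ν p.1 p.2).2.trans_lt h1
    have e2 : Iio t ∩ Icc 0 1 = Icc 0 1 := by
      ext p; simp; intro h1 h2; linarith
    rw [e1, e2]; simp

lemma ae_good (ν : Measure ℝ) [IsProbabilityMeasure ν] :
    ∀ᵐ y ∂ν, ∀ q : ℚ, (q : ℝ) < y → ν.real (Iic (q : ℝ)) < ν.real (Iic y) := by
  rw [ae_all_iff]
  intro q
  have hle : ∀ y : ℝ, (q : ℝ) < y → ¬ ν.real (Iic (q : ℝ)) < ν.real (Iic y) →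
      ν (Ioc (q : ℝ) y) = 0 := by
    intro y hy h
    have : ν.real (Iic y) = ν.real (Iic (q : ℝ)) + ν.real (Ioc (q : ℝ) y) := by
      rw [← measureReal_union (by
        rw [Set.disjoint_left]; intro x hx hx'; exact absurd hx'.1 (not_lt.mpr hx))
        measurableSet_Ioc, Iic_union_Ioc_eq_Iic hy.le]
    have h0 : ν.real (Ioc (q : ℝ) y) = 0 :=
      le_antisymm (by linarith) measureReal_nonneg
    simpa [measureReal_def, ENNReal.toReal_eq_zero_iff] using h0
  rw [ae_iff]
  set B := {y | ¬((q : ℝ) < y → ν.real (Iic (q : ℝ)) < ν.real (Iic y))} with hB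
  have hB' : ∀ y ∈ B, (q : ℝ) < y ∧ ν (Ioc (q : ℝ) y) = 0 := by
    intro y hy
    simp only [hB, mem_ofPred_eq, Classical.not_imp] at hy
    exact ⟨hy.1, hle y hy.1 hy.2⟩
  by_cases hmax : ∃ m ∈ B, ∀ y ∈ B, y ≤ m
  · obtain ⟨m, hm, hmm⟩ := hmax
    exact measure_mono_null (t := Ioc (q : ℝ) m)
      (fun y hy => ⟨(hB' y hy).1, hmm y hy⟩) (hB' m hm).2
  · push Not at hmax
    refine measure_null_of_locally_null B fun x hx => ?_
    obtain ⟨z, hz, hxz⟩ := hmax x hx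
    exact ⟨Ioc (q : ℝ) z, mem_nhdsWithin_of_mem_nhds (Ioc_mem_nhds (hB' x hx).1 hxz),
      (hB' z hz).2⟩

/-- Quantile function through rationals. -/
def qtl (ν : Measure ℝ) (h : ℝ) : EReal :=
  ⨅ q : ℚ, if h ≤ ν.real (Iic (q : ℝ)) then ((q : ℝ) : EReal) else ⊤

lemma qtl_rdf (ν : Measure ℝ) [IsProbabilityMeasure ν] (y : ℝ)
    (hy : ∀ q : ℚ, (q : ℝ) < y → ν.real (Iic (q : ℝ)) < ν.real (Iic y))
    (s : ℝ) (hs : s ∈ Ioc (0 : ℝ) 1) : qtl ν (rdf ν y s) = (y : EReal) := by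
  unfold qtl
  apply le_antisymm
  · refine le_of_forall_gt_imp_ge_of_dense fun b hb => ?_
    obtain ⟨q, hq1, hq2⟩ := EReal.exists_rat_btwn_of_lt hb
    refine (iInf_le _ q).trans ?_
    have hq1' : y < (q : ℝ) := by exact_mod_cast hq1
    have : rdf ν y s ≤ ν.real (Iic (q : ℝ)) :=
      (rdf_le ν y s).trans (measureReal_mono (Iic_subset_Iic.2 hq1'.le))
    rw [if_pos this]
    exact hq2.le
  · refine le_iInf fun q => ?_
    split_ifs with h
    · rw [EReal.coe_le_coe_iff]
      by_contra! hlt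
      have h1 := hy q hlt
      have h2 : ν.real (Iic (q : ℝ)) ≤ ν.real (Iio y) := measureReal_mono (Iic_subset_Iio.2 hlt)
      have h3 := real_Iio_le_Iic ν y
      rw [rdf, min_eq_left hs.2, max_eq_right hs.1.le] at h
      rcases h3.eq_or_lt with h4 | h4
      · rw [h4] at h; linarith
      · have := mul_pos hs.1 (sub_pos.2 h4)
        linarith
    · exact le_top

section gen
variable {A : Type*} [MeasurableSpace A] (κ : Kernel A ℝ) [IsMarkovKernel κ]

lemma measurable_kIic : Measurable (fun p : A × ℝ => (κ p.1).real (Iic p.2)) := by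
  have : MeasurableSet {z : (A × ℝ) × ℝ | z.2 ≤ z.1.2} :=
    measurableSet_le measurable_snd (measurable_snd.comp measurable_fst)
  exact (Kernel.measurable_kernel_prodMk_left (κ := κ.comap Prod.fst measurable_fst) this).ennreal_toReal

lemma measurable_kIio : Measurable (fun p : A × ℝ => (κ p.1).real (Iio p.2)) := by
  have : MeasurableSet {z : (A × ℝ) × ℝ | z.2 < z.1.2} :=
    measurableSet_lt measurable_snd (measurable_snd.comp measurable_fst)
  exact (Kernel.measurable_kernel_prodMk_left (κ := κ.comap Prod.fst measurable_fst) this).ennreal_toReal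

lemma measurable_krdf : Measurable (fun p : (A × ℝ) × ℝ => rdf (κ p.1.1) p.1.2 p.2) := by
  have h1 := (measurable_kIio κ).comp ((measurable_fst : Measurable (Prod.fst : (A × ℝ) × ℝ → A × ℝ)))
  have h2 := (measurable_kIic κ).comp ((measurable_fst : Measurable (Prod.fst : (A × ℝ) × ℝ → A × ℝ)))
  exact h1.add ((measurable_const.max (measurable_snd.min measurable_const)).mul (h2.sub h1))

lemma measurable_kqtl : Measurable (fun p : A × ℝ => qtl (κ p.1) p.2) := by
  refine Measurable.iInf fun q => Measurable.ite ?_ measurable_const measurable_const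
  refine measurableSet_le measurable_snd ?_
  exact (measurable_kIic κ).comp (measurable_fst.prodMk measurable_const)

lemma map_krdf (m : Measure A) [IsProbabilityMeasure m] :
    ((m ⊗ₘ κ).prod (volume.restrict (Ioc (0 : ℝ) 1))).map
      (fun p => (rdf (κ p.1.1) p.1.2 p.2, p.1.1)) =
    (volume.restrict (Icc (0 : ℝ) 1)).prod m := by
  have hU := measurable_krdf κ
  have hm : Measurable (fun p : (A × ℝ) × ℝ => (rdf (κ p.1.1) p.1.2 p.2, p.1.1)) :=
    hU.prodMk (measurable_fst.comp measurable_fst)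
  have := Measure.isFiniteMeasure_map ((m ⊗ₘ κ).prod (volume.restrict (Ioc (0 : ℝ) 1)))
    (fun p : (A × ℝ) × ℝ => (rdf (κ p.1.1) p.1.2 p.2, p.1.1))
  refine Measure.ext_prod fun {s t} hs ht => ?_
  rw [Measure.map_apply hm (hs.prod ht), Measure.prod_prod,
    Measure.prod_apply (hm (hs.prod ht)), Measure.lintegral_compProd
      (measurable_measure_prodMk_left (hm (hs.prod ht)))]
  have key : ∀ a, ∫⁻ b, (volume.restrict (Ioc (0 : ℝ) 1)) (Prod.mk (a, b) ⁻¹'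
      ((fun p : (A × ℝ) × ℝ => (rdf (κ p.1.1) p.1.2 p.2, p.1.1)) ⁻¹' s ×ˢ t)) ∂(κ a) =
      t.indicator (fun _ => (volume.restrict (Icc (0 : ℝ) 1)) s) a := by
    intro a
    by_cases ha : a ∈ t
    · rw [indicator_of_mem ha, ← map_rdf (κ a), Measure.map_apply (measurable_rdf _) hs,
        Measure.prod_apply (measurable_rdf _ hs)]
      refine lintegral_congr fun b => ?_
      congr 1
      ext x; simp [ha]
    · rw [indicator_of_notMem ha]
      have : ∀ b : ℝ, (Prod.mk (a, b) ⁻¹'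
        ((fun p : (A × ℝ) × ℝ => (rdf (κ p.1.1) p.1.2 p.2, p.1.1)) ⁻¹' s ×ˢ t)) = ∅ := by
        intro b; ext x; simp [ha]
      simp [this]
  simp_rw [key]
  rw [lintegral_indicator_const ht]

lemma factor_gen {Ω : Type*} [MeasurableSpace Ω] (μ : Measure Ω) [IsProbabilityMeasure μ]
    (π : Ω → A) (hπ : Measurable π) {X : Type*} [MeasurableSpace X] [StandardBorelSpace X]
    [Nonempty X] (d : Ω → X) (hd : Measurable d) :
    ∃ (H : Ω × ℝ → ℝ) (d0 : A × ℝ → X),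
      (∀ z, H z ∈ Set.Icc (0 : ℝ) 1) ∧ Measurable H ∧
      IndepFun H (fun z => π z.1) (μ.prod (volume.restrict (Set.Ioc (0 : ℝ) 1))) ∧
      Measure.map H (μ.prod (volume.restrict (Set.Ioc (0 : ℝ) 1))) =
        volume.restrict (Set.Icc (0 : ℝ) 1) ∧
      Measurable d0 ∧
      ∃ Nset : Set Ω, MeasurableSet Nset ∧ μ Nset = 0 ∧
        ∀ ω ∉ Nset, ∀ s ∈ Set.Ioc (0 : ℝ) 1, d0 (π ω, H (ω, s)) = d ω := by
  have he := measurableEmbedding_embeddingReal X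
  set e := embeddingReal X
  obtain ⟨g, hg, hge⟩ := he.exists_measurable_extend measurable_id (fun _ => ‹Nonempty X›)
  have hY : Measurable (fun ω => e (d ω)) := he.measurable.comp hd
  set Y := fun ω => e (d ω) with hYdef
  let κ : Kernel A ℝ := condDistrib Y π μ
  have hκ : (μ.map π) ⊗ₘ κ = μ.map fun a ↦ (π a, Y a) :=
    compProd_map_condDistrib hY.aemeasurable
  have : IsProbabilityMeasure (μ.map π) := Measure.isProbabilityMeasure_map hπ.aemeasurable
  have hpY : Measurable (fun a => (π a, Y a)) := hπ.prodMk hY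
  let H : Ω × ℝ → ℝ := fun z => rdf (κ (π z.1)) (Y z.1) z.2
  have hT : Measurable (Prod.map (fun a => (π a, Y a)) (id : ℝ → ℝ)) := hpY.prodMap measurable_id
  have hH : Measurable H := (measurable_krdf κ).comp hT
  have hπ1 : Measurable (fun z : Ω × ℝ => π z.1) := hπ.comp measurable_fst
  have hjoint : (μ.prod (volume.restrict (Ioc (0 : ℝ) 1))).map (fun z => (H z, π z.1)) =
      (volume.restrict (Icc (0 : ℝ) 1)).prod (μ.map π) := by
    rw [← map_krdf κ, hκ]
    conv_rhs => rw [← Measure.map_id (μ := volume.restrict (Ioc (0 : ℝ) 1))]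
    rw [Measure.map_prod_map _ _ hpY measurable_id, Measure.map_map _ hT]
    · rfl
    · exact (measurable_krdf κ).prodMk (measurable_fst.comp measurable_fst)
  have hmapH : (μ.prod (volume.restrict (Ioc (0 : ℝ) 1))).map H =
      volume.restrict (Icc (0 : ℝ) 1) := by
    rw [← Measure.fst_map_prodMk (X := H) hπ1, hjoint]
    simp
  have hmapπ : (μ.prod (volume.restrict (Ioc (0 : ℝ) 1))).map (fun z => π z.1) = μ.map π := by
    rw [← Measure.snd_map_prodMk (Y := fun z : Ω × ℝ => π z.1) hH, hjoint]
    simp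
  refine ⟨H, fun p => g (qtl (κ p.1) p.2).toReal, fun z => rdf_mem _ _ _, hH, ?_, hmapH, ?_, ?_⟩
  · rw [indepFun_iff_map_prod_eq_prod_map_map hH.aemeasurable hπ1.aemeasurable, hmapH, hmapπ,
      hjoint]
  · exact hg.comp (measurable_kqtl κ).ereal_toReal
  · have hms : MeasurableSet {p : A × ℝ | ∀ q : ℚ, (q : ℝ) < p.2 →
        (κ p.1).real (Iic (q : ℝ)) < (κ p.1).real (Iic p.2)} := by
      simp only [ofPred_forall]
      refine MeasurableSet.iInter fun q => ?_
      have h1 : MeasurableSet {p : A × ℝ | (q : ℝ) < p.2} :=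
        measurableSet_lt measurable_const measurable_snd
      have h2 : MeasurableSet {p : A × ℝ | (κ p.1).real (Iic (q : ℝ)) < (κ p.1).real (Iic p.2)} :=
        measurableSet_lt ((measurable_kIic κ).comp (measurable_fst.prodMk measurable_const))
          (measurable_kIic κ)
      have := h1.compl.union h2
      convert this using 1
      ext p; simp [imp_iff_not_or]
    have hae : ∀ᵐ p ∂((μ.map π) ⊗ₘ κ), ∀ q : ℚ, (q : ℝ) < p.2 →
        (κ p.1).real (Iic (q : ℝ)) < (κ p.1).real (Iic p.2) := by
      rw [Measure.ae_compProd_iff hms]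
      exact Eventually.of_forall fun a => ae_good (κ a)
    rw [hκ, ae_map_iff hpY.aemeasurable hms] at hae
    refine ⟨toMeasurable μ _, measurableSet_toMeasurable _ _,
      (measure_toMeasurable _).trans (ae_iff.1 hae), fun ω hω s hs => ?_⟩
    have hω' := fun h => hω (subset_toMeasurable μ _ h)
    replace hω' := not_not.1 hω'
    change g (qtl (κ (π ω)) (rdf (κ (π ω)) (Y ω) s)).toReal = d ω
    rw [qtl_rdf (κ (π ω)) (Y ω) hω' s hs, EReal.toReal_coe]
    exact congrFun hge (d ω)

end gen

/-- Factorization of an `X`-valued random variable `d` through a sub-σ-algebra `G`: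
on `Ω̄ = Ω × (0,1]` with `ℙ̄ = ℙ ⊗ λ` there are `H : Ω̄ → [0,1]`, uniformly distributed and
independent of `G ⊗ {∅,(0,1]}`, and a `G ⊗ B([0,1])`-measurable `d⁰ : Ω × [0,1] → X` with
`d(ω) = d⁰(ω, H(ω,s))` for all `(ω,s)` outside `N × (0,1]` for a `ℙ`-null set `N`. -/
theorem factorization_through_sub_sigma_algebra
    {Ω : Type*} (G : MeasurableSpace Ω) {m0 : MeasurableSpace Ω}
    (μ : Measure Ω) [IsProbabilityMeasure μ] (hG : G ≤ m0)
    {X : Type*} [MeasurableSpace X] [NormedAddCommGroup X] [NormedSpace ℝ X]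
    [BorelSpace X] [TopologicalSpace.SeparableSpace X] [CompleteSpace X]
    (d : Ω → X) (hd : Measurable d) :
    ∃ (H : Ω × ℝ → ℝ) (d0 : Ω × ℝ → X),
      -- (1) `H` is a uniformly-`[0,1]` distributed random variable independent of
      --     `G ⊗ {∅,(0,1]}`
      (∀ z, H z ∈ Set.Icc (0 : ℝ) 1) ∧
      Measurable H ∧
      Indep (MeasurableSpace.comap H inferInstance) (MeasurableSpace.comap Prod.fst G)
        (μ.prod (volume.restrict (Set.Ioc (0 : ℝ) 1))) ∧
      Measure.map H (μ.prod (volume.restrict (Set.Ioc (0 : ℝ) 1))) =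
        volume.restrict (Set.Icc (0 : ℝ) 1) ∧
      -- (2) `d⁰` is `G ⊗ B([0,1])`-measurable
      Measurable[MeasurableSpace.prod G (inferInstance : MeasurableSpace ℝ)] d0 ∧
      -- (3) `d(ω) = d⁰(ω, H(ω,s))` off a null set
      ∃ Nset : Set Ω, MeasurableSet Nset ∧ μ Nset = 0 ∧
        ∀ ω ∉ Nset, ∀ s ∈ Set.Ioc (0 : ℝ) 1, d0 (ω, H (ω, s)) = d ω := by
  obtain ⟨H, d0, h1, h2, h3, h4, h5, N, h6, h7, h8⟩ :=
    @factor_gen Ω G Ω m0 μ _ id (measurable_id'' hG) X _ inferInstance inferInstance d hd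
  exact ⟨H, d0, h1, h2, h3, h4, h5, N, h6, h7, h8⟩
end
end

section
/- Let X be a separable Banach space, p ∈ (0,∞), and let P ⊆ P_p(X) be non-empty. Let d₀ be any metric on P(X) that metrizes weak convergence of probability measures, and define d_p(μ,ν) := d₀(μ,ν) + | ∫_X ‖x‖^p dμ(x) − ∫_X ‖x‖^p dν(x) | on P_p(X). Then: (1) (P_{p-ext})_{p-ext} = P_{p-ext}; (2) P_{p-ext} is the smallest d_p-closed subset Q of P_p(X) such that P ⊆ Q and μ * ν ∈ Q for all μ, ν ∈ Q. -/
open MeasureTheory ProbabilityTheory Filter Set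
open scoped ENNReal NNReal Topology

noncomputable section

def WeakConv {X : Type*} [MeasurableSpace X] [TopologicalSpace X]
    (μs : ℕ → Measure X) (μ : Measure X) : Prop :=
  ∀ f : BoundedContinuousFunction X ℝ,
    Tendsto (fun n => ∫ x, f x ∂(μs n)) atTop (𝓝 (∫ x, f x ∂μ))

def UnifInt {X : Type*} [MeasurableSpace X] [NormedAddCommGroup X] (p : ℝ)
    {ι : Type*} (μs : ι → Measure X) : Prop :=
  ∀ ε : ℝ, 0 < ε → ∃ K : ℝ, ∀ i, (∫ x in {x : X | K ≤ ‖x‖}, ‖x‖ ^ p ∂(μs i)) < ε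

def MemPp {X : Type*} [MeasurableSpace X] [NormedAddCommGroup X] (p : ℝ)
    (μ : Measure X) : Prop :=
  IsProbabilityMeasure μ ∧ Integrable (fun x => ‖x‖ ^ p) μ

def mconv {X : Type*} [MeasurableSpace X] [Add X] (μ ν : Measure X) : Measure X :=
  (μ.prod ν).map (fun q => q.1 + q.2)

def finConv {X : Type*} [MeasurableSpace X] [AddMonoid X] {K : ℕ}
    (ν : Fin K → Measure X) : Measure X :=
  (List.ofFn ν).foldr mconv (Measure.dirac 0)

def pExt {X : Type*} [MeasurableSpace X] [NormedAddCommGroup X] (p : ℝ)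
    (P : Set (Measure X)) : Set (Measure X) :=
  {μ | MemPp p μ ∧ ∃ (K : ℕ → ℕ) (ν : (j : ℕ) → Fin (K j) → Measure X),
    (∀ j, 0 < K j) ∧ (∀ j k, ν j k ∈ P) ∧
    WeakConv (fun j => finConv (ν j)) μ ∧ UnifInt p (fun j => finConv (ν j))}

section Helpers

variable {X : Type*} [MeasurableSpace X] [NormedAddCommGroup X]

def tailFun (p : ℝ) (K : ℝ) : X → ℝ := indicator {x : X | K ≤ ‖x‖} (fun x => ‖x‖ ^ p)

lemma tailFun_nonneg (p K : ℝ) (x : X) : 0 ≤ tailFun p K x :=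
  indicator_nonneg (fun _ _ => Real.rpow_nonneg (norm_nonneg _) _) x

lemma tailFun_anti (p : ℝ) {K L : ℝ} (h : K ≤ L) (x : X) : tailFun p L x ≤ tailFun p K x := by
  unfold tailFun
  apply indicator_le_indicator_of_subset
  · intro y hy
    exact h.trans hy
  · intro y
    exact Real.rpow_nonneg (norm_nonneg _) _

variable [BorelSpace X]

lemma measSet_tail (K : ℝ) : MeasurableSet {x : X | K ≤ ‖x‖} :=
  measurableSet_le measurable_const measurable_norm

lemma setInt_eq (p K : ℝ) (μ : Measure X) :
    (∫ x in {x : X | K ≤ ‖x‖}, ‖x‖ ^ p ∂μ) = ∫ x, tailFun p K x ∂μ :=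
  (integral_indicator (measSet_tail K)).symm

lemma tailFun_int {p : ℝ} (K : ℝ) {μ : Measure X} (h : MemPp p μ) :
    Integrable (tailFun p K) μ := h.2.indicator (measSet_tail K)

lemma tail_mono {p K L : ℝ} (h : K ≤ L) {μ : Measure X} (hμ : MemPp p μ) :
    ∫ x, tailFun p L x ∂μ ≤ ∫ x, tailFun p K x ∂μ :=
  integral_mono (tailFun_int _ hμ) (tailFun_int _ hμ) (tailFun_anti p h)

lemma tail_tendsto {p : ℝ} {μ : Measure X} (hμ : MemPp p μ) :
    Tendsto (fun K : ℝ => ∫ x, tailFun p K x ∂μ) atTop (𝓝 0) := by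
  have := tendsto_integral_filter_of_dominated_convergence (μ := μ) (l := (atTop : Filter ℝ))
    (F := fun K x => tailFun p K x) (f := fun _ => (0 : ℝ)) (fun x => ‖x‖ ^ p)
    (Eventually.of_forall fun K => (tailFun_int K hμ).aestronglyMeasurable)
    (Eventually.of_forall fun K => Eventually.of_forall fun x => by
      rw [Real.norm_of_nonneg (tailFun_nonneg _ _ _)]
      exact indicator_le_self' (fun _ _ => Real.rpow_nonneg (norm_nonneg _) _) x)
    hμ.2
    (Eventually.of_forall fun x => by
      apply tendsto_const_nhds.congr'
      filter_upwards [eventually_gt_atTop ‖x‖] with K hK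
      simp [tailFun, hK])
  simpa using this

lemma unifInt_const {p : ℝ} {ι : Type*} {μ : Measure X} (hμ : MemPp p μ) :
    UnifInt p (fun _ : ι => μ) := by
  intro ε hε
  obtain ⟨K, hK⟩ := ((tail_tendsto hμ).eventually (gt_mem_nhds hε)).exists
  exact ⟨K, fun _ => by rw [setInt_eq]; exact hK⟩

lemma tail_add_le {p : ℝ} (hp : 0 < p) {K : ℝ} (x y : X) :
    tailFun p (2 * K) (x + y) ≤ 2 ^ p * (tailFun p K x + tailFun p K y) := by
  have h2 : (0 : ℝ) ≤ 2 ^ p := by positivity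
  by_cases h : 2 * K ≤ ‖x + y‖
  · have e : tailFun p (2 * K) (x + y) = ‖x + y‖ ^ p := by
      simp [tailFun, h]
    rw [e]
    have ht := norm_add_le x y
    rcases le_total ‖x‖ ‖y‖ with hxy | hxy
    · have e2 : tailFun p K y = ‖y‖ ^ p := by
        have : K ≤ ‖y‖ := by linarith
        simp [tailFun, this]
      calc ‖x + y‖ ^ p ≤ (2 * ‖y‖) ^ p :=
            Real.rpow_le_rpow (norm_nonneg _) (by linarith) hp.le
        _ = 2 ^ p * tailFun p K y := by
            rw [e2, Real.mul_rpow (by norm_num) (norm_nonneg _)]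
        _ ≤ _ := mul_le_mul_of_nonneg_left (by linarith [tailFun_nonneg p K x]) h2
    · have e2 : tailFun p K x = ‖x‖ ^ p := by
        have : K ≤ ‖x‖ := by linarith
        simp [tailFun, this]
      calc ‖x + y‖ ^ p ≤ (2 * ‖x‖) ^ p :=
            Real.rpow_le_rpow (norm_nonneg _) (by linarith) hp.le
        _ = 2 ^ p * tailFun p K x := by
            rw [e2, Real.mul_rpow (by norm_num) (norm_nonneg _)]
        _ ≤ _ := mul_le_mul_of_nonneg_left (by linarith [tailFun_nonneg p K y]) h2
  · have e : tailFun p (2 * K) (x + y) = 0 := by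
      simp only [tailFun]
      exact indicator_of_notMem (s := {x : X | 2 * K ≤ ‖x‖}) h _
    rw [e]
    have := tailFun_nonneg p K x
    have := tailFun_nonneg p K y
    positivity

lemma tailFun_zero (p : ℝ) (x : X) : tailFun p 0 x = ‖x‖ ^ p := by simp [tailFun]

/-- truncation error -/
def exc (p M : ℝ) (μ : Measure X) : ℝ := ∫ x, (‖x‖ ^ p - min (‖x‖ ^ p) M) ∂μ

def truncB (p : ℝ) (hp : 0 < p) (M : ℝ) : BoundedContinuousFunction X ℝ :=
  BoundedContinuousFunction.ofNormedAddCommGroup (fun x => min (‖x‖ ^ p) M)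
    (((continuous_norm).rpow_const (fun _ => Or.inr hp.le)).min continuous_const) |M| (by
      intro x
      have : 0 ≤ ‖x‖ ^ p := Real.rpow_nonneg (norm_nonneg _) _
      rw [Real.norm_eq_abs, abs_le]
      constructor
      · apply le_min
        · linarith [abs_nonneg M]
        · exact neg_abs_le M
      · exact (min_le_right _ _).trans (le_abs_self M))

lemma trunc_int {p : ℝ} (hp : 0 < p) (M : ℝ) {μ : Measure X} (hμ : MemPp p μ) :
    Integrable (fun x => min (‖x‖ ^ p) M) μ := by
  have := hμ.1
  exact (truncB (X := X) p hp M).integrable μ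

lemma exc_eq {p : ℝ} (hp : 0 < p) (M : ℝ) {μ : Measure X} (hμ : MemPp p μ) :
    exc p M μ = (∫ x, ‖x‖ ^ p ∂μ) - ∫ x, truncB (X := X) p hp M x ∂μ :=
  integral_sub hμ.2 (trunc_int hp M hμ)

lemma exc_nonneg (p M : ℝ) (μ : Measure X) : 0 ≤ exc p M μ :=
  integral_nonneg fun x => sub_nonneg.2 (min_le_left _ _)

lemma exc_le_tail {p : ℝ} (hp : 0 < p) {K : ℝ} (hK : 0 ≤ K) {μ : Measure X} (hμ : MemPp p μ) :
    exc p (K ^ p) μ ≤ ∫ x, tailFun p K x ∂μ := by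
  refine integral_mono (hμ.2.sub (trunc_int hp _ hμ)) (tailFun_int _ hμ) fun x => ?_
  show ‖x‖ ^ p - min (‖x‖ ^ p) (K ^ p) ≤ tailFun p K x
  by_cases h : K ≤ ‖x‖
  · have e : tailFun p K x = ‖x‖ ^ p := by simp [tailFun, h]
    have h0 : 0 ≤ ‖x‖ ^ p := Real.rpow_nonneg (norm_nonneg _) _
    have h1 : 0 ≤ K ^ p := Real.rpow_nonneg hK _
    rw [e]
    linarith [le_min h0 h1]
  · have h' := Real.rpow_le_rpow (norm_nonneg x) (not_le.1 h).le hp.le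
    rw [min_eq_left h', sub_self]
    exact tailFun_nonneg _ _ _

lemma tail_le_exc {p : ℝ} (hp : 0 < p) {K : ℝ} (hK : 0 ≤ K) {μ : Measure X} (hμ : MemPp p μ) :
    ∫ x, tailFun p ((2 * K ^ p) ^ p⁻¹) x ∂μ ≤ 2 * exc p (K ^ p) μ := by
  unfold exc
  rw [← integral_const_mul]
  refine integral_mono (tailFun_int _ hμ)
    ((hμ.2.sub (trunc_int hp _ hμ)).const_mul 2) fun x => ?_
  show tailFun p _ x ≤ 2 * (‖x‖ ^ p - min (‖x‖ ^ p) (K ^ p))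
  by_cases h : (2 * K ^ p) ^ p⁻¹ ≤ ‖x‖
  · have e : tailFun p ((2 * K ^ p) ^ p⁻¹) x = ‖x‖ ^ p := by
      simp only [tailFun]
      exact indicator_of_mem (s := {x : X | (2 * K ^ p) ^ p⁻¹ ≤ ‖x‖}) h _
    have h1 : 0 ≤ K ^ p := Real.rpow_nonneg hK _
    have h2 := Real.rpow_le_rpow (by positivity) h hp.le
    rw [Real.rpow_inv_rpow (by positivity) hp.ne'] at h2
    rw [e]
    linarith [min_le_right (‖x‖ ^ p) (K ^ p)]
  · have e : tailFun p ((2 * K ^ p) ^ p⁻¹) x = 0 := by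
      simp only [tailFun]
      exact indicator_of_notMem (s := {x : X | (2 * K ^ p) ^ p⁻¹ ≤ ‖x‖}) h _
    rw [e]
    linarith [min_le_left (‖x‖ ^ p) (K ^ p)]

lemma moments_of_unifInt {p : ℝ} (hp : 0 < p) {μ : Measure X} (hμ : MemPp p μ)
    {μs : ℕ → Measure X} (hμs : ∀ n, MemPp p (μs n)) (hw : WeakConv μs μ)
    (hu : UnifInt p μs) :
    Tendsto (fun n => ∫ x, ‖x‖ ^ p ∂(μs n)) atTop (𝓝 (∫ x, ‖x‖ ^ p ∂μ)) := by
  rw [Metric.tendsto_atTop]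
  intro ε hε
  obtain ⟨K1, hK1⟩ := hu (ε / 3) (by positivity)
  obtain ⟨K2, hK2⟩ := ((tail_tendsto hμ).eventually (gt_mem_nhds (show 0 < ε / 3 by positivity))).exists
  set K := max (max K1 K2) 0 with hK
  have hK0 : 0 ≤ K := le_max_right _ _
  have a1 : ∀ n, exc p (K ^ p) (μs n) < ε / 3 := fun n => by
    refine (exc_le_tail hp hK0 (hμs n)).trans_lt ?_
    refine (tail_mono ((le_max_left K1 K2).trans (le_max_left _ 0)) (hμs n)).trans_lt ?_
    rw [← setInt_eq]
    exact hK1 n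
  have a2 : exc p (K ^ p) μ < ε / 3 := by
    refine (exc_le_tail hp hK0 hμ).trans_lt ?_
    exact (tail_mono ((le_max_right K1 K2).trans (le_max_left _ 0)) hμ).trans_lt hK2
  obtain ⟨N, hN⟩ := Metric.tendsto_atTop.1 (hw (truncB p hp (K ^ p))) (ε / 3) (by positivity)
  refine ⟨N, fun n hn => ?_⟩
  have h3 := hN n hn
  have h1 := a1 n
  have h1' := exc_nonneg p (K ^ p) (μs n)
  have h2' := exc_nonneg p (K ^ p) μ
  rw [exc_eq hp _ (hμs n)] at h1 h1'
  rw [exc_eq hp _ hμ] at a2 h2'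
  rw [Real.dist_eq, abs_lt] at h3 ⊢
  constructor <;> linarith [h3.1, h3.2]

lemma unifInt_of_moments {p : ℝ} (hp : 0 < p) {μ : Measure X} (hμ : MemPp p μ)
    {μs : ℕ → Measure X} (hμs : ∀ n, MemPp p (μs n)) (hw : WeakConv μs μ)
    (hm : Tendsto (fun n => ∫ x, ‖x‖ ^ p ∂(μs n)) atTop (𝓝 (∫ x, ‖x‖ ^ p ∂μ))) :
    UnifInt p μs := by
  intro ε hε
  obtain ⟨K, hK, hK0⟩ := (((tail_tendsto hμ).eventually
    (gt_mem_nhds (show 0 < ε / 2 by positivity))).and (eventually_ge_atTop 0)).exists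
  have ht : Tendsto (fun n => exc p (K ^ p) (μs n)) atTop (𝓝 (exc p (K ^ p) μ)) := by
    rw [exc_eq hp _ hμ]
    exact (hm.sub (hw (truncB p hp (K ^ p)))).congr fun n => (exc_eq hp _ (hμs n)).symm
  obtain ⟨N, hN⟩ := eventually_atTop.1 (ht.eventually
    (gt_mem_nhds ((exc_le_tail hp hK0 hμ).trans_lt hK)))
  have hf : ∀ᶠ L in (atTop : Filter ℝ), ∀ n ∈ Finset.range N,
      ∫ x, tailFun p L x ∂(μs n) < ε := by
    rw [Filter.eventually_all_finset]
    exact fun n _ => (tail_tendsto (hμs n)).eventually (gt_mem_nhds hε)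
  obtain ⟨L, hL, hL'⟩ := (hf.and (eventually_ge_atTop ((2 * K ^ p) ^ p⁻¹))).exists
  refine ⟨L, fun n => ?_⟩
  rw [setInt_eq]
  by_cases hn : n < N
  · exact hL n (Finset.mem_range.2 hn)
  · have h1 := hN n (not_lt.1 hn)
    have h2 := tail_le_exc hp hK0 (hμs n)
    have h3 := tail_mono hL' (hμs n)
    linarith

variable [TopologicalSpace.SeparableSpace X]

lemma int_prod_bound {p : ℝ} (K : ℝ) {μ ν : Measure X} (hμ : MemPp p μ) (hν : MemPp p ν) :
    Integrable (fun q : X × X => 2 ^ p * (tailFun p K q.1 + tailFun p K q.2)) (μ.prod ν) := by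
  have := hμ.1
  have := hν.1
  exact (((tailFun_int K hμ).comp_fst ν).add ((tailFun_int K hν).comp_snd μ)).const_mul _

lemma memPp_mconv {p : ℝ} (hp : 0 < p) {μ ν : Measure X} (hμ : MemPp p μ) (hν : MemPp p ν) :
    MemPp p (mconv μ ν) := by
  have := hμ.1
  have := hν.1
  have : SecondCountableTopology X := UniformSpace.secondCountable_of_separable X
  have hm : Measurable (fun q : X × X => q.1 + q.2) := by fun_prop
  have hn : Measurable (fun x : X => ‖x‖ ^ p) := by fun_prop
  refine ⟨Measure.isProbabilityMeasure_map hm.aemeasurable, ?_⟩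
  unfold mconv
  rw [integrable_map_measure hn.aestronglyMeasurable hm.aemeasurable]
  refine (int_prod_bound 0 hμ hν).mono' (hn.comp hm).aestronglyMeasurable
    (Eventually.of_forall fun q => ?_)
  have := tail_add_le (K := 0) hp q.1 q.2
  rw [mul_zero, tailFun_zero] at this
  simpa [abs_of_nonneg (Real.rpow_nonneg (norm_nonneg (q.1 + q.2)) p)] using this

lemma tail_mconv {p : ℝ} (hp : 0 < p) (K : ℝ) {μ ν : Measure X}
    (hμ : MemPp p μ) (hν : MemPp p ν) :
    ∫ x, tailFun p (2 * K) x ∂(mconv μ ν) ≤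
      2 ^ p * (∫ x, tailFun p K x ∂μ + ∫ x, tailFun p K x ∂ν) := by
  have := hμ.1
  have := hν.1
  have : SecondCountableTopology X := UniformSpace.secondCountable_of_separable X
  have hm : Measurable (fun q : X × X => q.1 + q.2) := by fun_prop
  have hi := tailFun_int (2 * K) (memPp_mconv hp hμ hν)
  unfold mconv at hi ⊢
  rw [integral_map hm.aemeasurable hi.aestronglyMeasurable]
  have hi2 := (integrable_map_measure hi.aestronglyMeasurable hm.aemeasurable).1 hi
  refine (integral_mono hi2 (int_prod_bound K hμ hν) fun q => tail_add_le hp q.1 q.2).trans_eq ?_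
  rw [integral_const_mul, integral_add ((tailFun_int K hμ).comp_fst ν)
    ((tailFun_int K hν).comp_snd μ), integral_fun_fst, integral_fun_snd]
  simp

lemma unifInt_mconv {p : ℝ} (hp : 0 < p) {μs νs : ℕ → Measure X} (hμ : ∀ n, MemPp p (μs n))
    (hν : ∀ n, MemPp p (νs n)) (h1 : UnifInt p μs) (h2 : UnifInt p νs) :
    UnifInt p (fun n => mconv (μs n) (νs n)) := by
  intro ε hε
  have h2p : (0 : ℝ) < 2 ^ p := by positivity
  set δ := ε / 2 ^ p / 2 with hδ
  have hδ0 : 0 < δ := by positivity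
  obtain ⟨K1, hK1⟩ := h1 δ hδ0
  obtain ⟨K2, hK2⟩ := h2 δ hδ0
  refine ⟨2 * max K1 K2, fun n => ?_⟩
  rw [setInt_eq]
  refine (tail_mconv hp _ (hμ n) (hν n)).trans_lt ?_
  have a1 := hK1 n
  have a2 := hK2 n
  rw [setInt_eq] at a1 a2
  have b1 := tail_mono (le_max_left K1 K2) (hμ n)
  have b2 := tail_mono (le_max_right K1 K2) (hν n)
  calc _ < 2 ^ p * (δ + δ) := by
        apply mul_lt_mul_of_pos_left _ h2p
        linarith
    _ = ε := by rw [hδ]; field_simp; ring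

lemma weakConv_mconv {μ ν : Measure X} {μs νs : ℕ → Measure X}
    (hμ : IsProbabilityMeasure μ) (hν : IsProbabilityMeasure ν)
    (hμs : ∀ n, IsProbabilityMeasure (μs n)) (hνs : ∀ n, IsProbabilityMeasure (νs n))
    (h1 : WeakConv μs μ) (h2 : WeakConv νs ν) :
    WeakConv (fun n => mconv (μs n) (νs n)) (mconv μ ν) := by
  have : SecondCountableTopology X := UniformSpace.secondCountable_of_separable X
  let M : ProbabilityMeasure X := ⟨μ, hμ⟩
  let N : ProbabilityMeasure X := ⟨ν, hν⟩
  let Ms : ℕ → ProbabilityMeasure X := fun n => ⟨μs n, hμs n⟩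
  let Ns : ℕ → ProbabilityMeasure X := fun n => ⟨νs n, hνs n⟩
  have t1 : Tendsto Ms atTop (𝓝 M) :=
    ProbabilityMeasure.tendsto_iff_forall_integral_tendsto.2 h1
  have t2 : Tendsto Ns atTop (𝓝 N) :=
    ProbabilityMeasure.tendsto_iff_forall_integral_tendsto.2 h2
  have t3 := (ProbabilityMeasure.continuous_prod.tendsto (M, N)).comp (t1.prodMk_nhds t2)
  have t4 := ProbabilityMeasure.tendsto_map_of_tendsto_of_continuous _ _ t3
    (continuous_add (M := X))
  exact ProbabilityMeasure.tendsto_iff_forall_integral_tendsto.1 t4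

lemma mconv_assoc' {μ ν ρ : Measure X} [SFinite ν] [SFinite ρ] :
    mconv (mconv μ ν) ρ = mconv μ (mconv ν ρ) := by
  have : SecondCountableTopology X := UniformSpace.secondCountable_of_separable X
  exact Measure.conv_assoc μ ν ρ

lemma mconv_dirac' {μ : Measure X} [SFinite μ] : mconv μ (Measure.dirac 0) = μ := by
  have : SecondCountableTopology X := UniformSpace.secondCountable_of_separable X
  exact Measure.conv_dirac_zero μ

lemma dirac_mconv' {μ : Measure X} [SFinite μ] : mconv (Measure.dirac 0) μ = μ := by
  have : SecondCountableTopology X := UniformSpace.secondCountable_of_separable X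
  exact Measure.dirac_zero_conv μ

def lconv (l : List (Measure X)) : Measure X := l.foldr mconv (Measure.dirac 0)

lemma memPp_lconv {p : ℝ} (hp : 0 < p) (l : List (Measure X)) (h : ∀ μ ∈ l, MemPp p μ) :
    MemPp p (lconv l) := by
  induction l with
  | nil =>
    refine ⟨by unfold lconv; simp only [List.foldr_nil]; infer_instance, ?_⟩
    exact integrable_dirac (by simp)
  | cons a l ih =>
    exact memPp_mconv hp (h a (by simp)) (ih fun μ hμ => h μ (by simp [hμ]))

lemma lconv_append {p : ℝ} (hp : 0 < p) (l m : List (Measure X)) (h : ∀ μ ∈ l, MemPp p μ)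
    (h' : ∀ μ ∈ m, MemPp p μ) : lconv (l ++ m) = mconv (lconv l) (lconv m) := by
  have := (memPp_lconv hp m h').1
  induction l with
  | nil =>
    show lconv m = mconv (Measure.dirac 0) (lconv m)
    exact dirac_mconv'.symm
  | cons a l ih =>
    have hl : ∀ μ ∈ l, MemPp p μ := fun μ hμ => h μ (by simp [hμ])
    have := (memPp_lconv hp l hl).1
    show mconv a (lconv (l ++ m)) = mconv (mconv a (lconv l)) (lconv m)
    rw [ih hl, mconv_assoc']

lemma lconv_mem {p : ℝ} (Q : Set (Measure X)) (hQ : ∀ μ ∈ Q, MemPp p μ)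
    (hc : ∀ μ ∈ Q, ∀ ν ∈ Q, mconv μ ν ∈ Q) (l : List (Measure X)) (hl : l ≠ [])
    (h : ∀ μ ∈ l, μ ∈ Q) : lconv l ∈ Q := by
  induction l with
  | nil => exact absurd rfl hl
  | cons a l ih =>
    have ha := h a (by simp)
    by_cases hn : l = []
    · subst hn
      have := (hQ a ha).1
      show mconv a (Measure.dirac 0) ∈ Q
      rw [mconv_dirac']
      exact ha
    · exact hc a ha _ (ih hn fun μ hμ => h μ (by simp [hμ]))

lemma mem_pExt {p : ℝ} {P : Set (Measure X)} {μ : Measure X} :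
    μ ∈ pExt p P ↔ MemPp p μ ∧ ∃ l : ℕ → List (Measure X),
      (∀ j, l j ≠ []) ∧ (∀ j, ∀ m ∈ l j, m ∈ P) ∧
      WeakConv (fun j => lconv (l j)) μ ∧ UnifInt p (fun j => lconv (l j)) := by
  constructor
  · rintro ⟨h, K, ν, hK, hν, hw, hu⟩
    refine ⟨h, fun j => List.ofFn (ν j), fun j => ?_, fun j m hm => ?_, hw, hu⟩
    · have := hK j
      simp only [ne_eq, List.ofFn_eq_nil_iff]
      omega
    · obtain ⟨k, rfl⟩ := (List.mem_ofFn' _ _).1 hm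
      exact hν j k
  · rintro ⟨h, l, hl, hP, hw, hu⟩
    have e : ∀ j, finConv (fun k => (l j).get k) = lconv (l j) := fun j => by
      unfold finConv lconv
      rw [List.ofFn_get]
    refine ⟨h, fun j => (l j).length, fun j k => (l j).get k,
      fun j => List.length_pos_iff.2 (hl j), fun j k => hP j _ (List.get_mem _ _), ?_, ?_⟩
    · simp only [e]
      exact hw
    · simp only [e]
      exact hu

lemma subset_pExt {p : ℝ} {P : Set (Measure X)} (hP : ∀ μ ∈ P, MemPp p μ) :
    P ⊆ pExt p P := by
  intro μ hμ
  have := (hP μ hμ).1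
  have e : lconv [μ] = μ := mconv_dirac'
  refine mem_pExt.2 ⟨hP μ hμ, fun _ => [μ], by simp, by simpa using hμ, ?_, ?_⟩
  · simp only [e]
    exact fun f => tendsto_const_nhds
  · simp only [e]
    exact unifInt_const (hP μ hμ)

lemma mconv_pExt {p : ℝ} (hp : 0 < p) {P : Set (Measure X)} (hP : ∀ μ ∈ P, MemPp p μ)
    {μ ν : Measure X} (hμ : μ ∈ pExt p P) (hν : ν ∈ pExt p P) : mconv μ ν ∈ pExt p P := by
  obtain ⟨a, l, hl, hlP, hw, hu⟩ := mem_pExt.1 hμ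
  obtain ⟨b, m, hm, hmP, hw', hu'⟩ := mem_pExt.1 hν
  have hl' := fun j => memPp_lconv hp (l j) fun μ h => hP μ (hlP j μ h)
  have hm' := fun j => memPp_lconv hp (m j) fun μ h => hP μ (hmP j μ h)
  have e : ∀ j, lconv (l j ++ m j) = mconv (lconv (l j)) (lconv (m j)) := fun j =>
    lconv_append hp _ _ (fun μ h => hP μ (hlP j μ h)) (fun μ h => hP μ (hmP j μ h))
  refine mem_pExt.2 ⟨memPp_mconv hp a b, fun j => l j ++ m j, ?_, ?_, ?_, ?_⟩
  · intro j
    simp [hl j]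
  · intro j ρ hρ
    rcases List.mem_append.1 hρ with h | h
    · exact hlP j ρ h
    · exact hmP j ρ h
  · simp only [e]
    exact weakConv_mconv a.1 b.1 (fun n => (hl' n).1) (fun n => (hm' n).1) hw hw'
  · simp only [e]
    exact unifInt_mconv hp hl' hm' hu hu'

end Helpers

/-- Basic properties of `P_{p-ext}`: it is idempotent, and it is the smallest `d_p`-closed
subset of `P_p(X)` containing `P` and closed under convolution, where
`d_p(μ,ν) = d₀(μ,ν) + |∫‖x‖^p dμ - ∫‖x‖^p dν|` for any metric `d₀` on the probability
measures metrizing weak convergence. -/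
theorem pExt_idem_and_smallest_closed_conv_stable
    {X : Type*} [MeasurableSpace X] [NormedAddCommGroup X] [NormedSpace ℝ X]
    [BorelSpace X] [TopologicalSpace.SeparableSpace X] [CompleteSpace X]
    (p : ℝ) (hp : 0 < p)
    (P : Set (Measure X)) (hPne : P.Nonempty) (hPsub : ∀ μ ∈ P, MemPp p μ)
    (d0 : Measure X → Measure X → ℝ)
    (hnonneg : ∀ μ ν : Measure X, IsProbabilityMeasure μ → IsProbabilityMeasure ν →
      0 ≤ d0 μ ν)
    (hsymm : ∀ μ ν : Measure X, IsProbabilityMeasure μ → IsProbabilityMeasure ν →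
      d0 μ ν = d0 ν μ)
    (heq : ∀ μ ν : Measure X, IsProbabilityMeasure μ → IsProbabilityMeasure ν →
      (d0 μ ν = 0 ↔ μ = ν))
    (htriangle : ∀ μ ν ρ : Measure X, IsProbabilityMeasure μ → IsProbabilityMeasure ν →
      IsProbabilityMeasure ρ → d0 μ ρ ≤ d0 μ ν + d0 ν ρ)
    (hmetrize : ∀ (ν : Measure X) (νs : ℕ → Measure X), IsProbabilityMeasure ν →
      (∀ n, IsProbabilityMeasure (νs n)) →
      (Tendsto (fun n => d0 (νs n) ν) atTop (𝓝 0) ↔ WeakConv νs ν)) :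
    -- the metric `d_p`
    ∀ dp : Measure X → Measure X → ℝ,
      (∀ μ ν, dp μ ν = d0 μ ν + |(∫ x, ‖x‖ ^ p ∂μ) - ∫ x, ‖x‖ ^ p ∂ν|) →
      -- (1) idempotence
      pExt p (pExt p P) = pExt p P ∧
      -- (2) `pExt p P` is a `d_p`-closed subset of `P_p(X)` containing `P`
      --     and closed under convolution …
      (∀ μ ∈ pExt p P, MemPp p μ) ∧
      P ⊆ pExt p P ∧
      (∀ μ ∈ pExt p P, ∀ ν ∈ pExt p P, mconv μ ν ∈ pExt p P) ∧
      (∀ μ : Measure X, MemPp p μ →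
        (∀ ε : ℝ, 0 < ε → ∃ ν ∈ pExt p P, dp μ ν < ε) → μ ∈ pExt p P) ∧
      -- … and it is the smallest such set.
      (∀ Q : Set (Measure X), (∀ μ ∈ Q, MemPp p μ) → P ⊆ Q →
        (∀ μ ∈ Q, ∀ ν ∈ Q, mconv μ ν ∈ Q) →
        (∀ μ : Measure X, MemPp p μ →
          (∀ ε : ℝ, 0 < ε → ∃ ν ∈ Q, dp μ ν < ε) → μ ∈ Q) →
        pExt p P ⊆ Q) := by
  intro dp hdp
  have key : ∀ (P : Set (Measure X)), (∀ μ ∈ P, MemPp p μ) → ∀ μ ∈ pExt p P,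
      ∀ ε : ℝ, 0 < ε → ∃ l : List (Measure X), l ≠ [] ∧ (∀ m ∈ l, m ∈ P) ∧
        dp μ (lconv l) < ε := by
    intro P hP μ hμ ε hε
    obtain ⟨a, l, hl, hlP, hw, hu⟩ := mem_pExt.1 hμ
    have hl' := fun j => memPp_lconv hp (l j) fun μ h => hP μ (hlP j μ h)
    have t1 := (hmetrize μ _ a.1 (fun n => (hl' n).1)).2 hw
    have t2 := moments_of_unifInt hp a hl' hw hu
    have t3 : Tendsto (fun n => dp μ (lconv (l n))) atTop (𝓝 0) := by
      have : Tendsto (fun n => d0 (lconv (l n)) μ +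
          |(∫ x, ‖x‖ ^ p ∂μ) - ∫ x, ‖x‖ ^ p ∂(lconv (l n))|) atTop (𝓝 0) := by
        simpa using t1.add ((tendsto_const_nhds (x := ∫ x, ‖x‖ ^ p ∂μ)).sub t2).abs
      refine this.congr fun n => ?_
      rw [hdp, hsymm _ _ (hl' n).1 a.1]
    obtain ⟨n, hn⟩ := (t3.eventually (gt_mem_nhds hε)).exists
    exact ⟨l n, hl n, hlP n, hn⟩
  have hmem : ∀ μ ∈ pExt p P, MemPp p μ := fun μ h => h.1
  have hconv : ∀ μ ∈ pExt p P, ∀ ν ∈ pExt p P, mconv μ ν ∈ pExt p P :=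
    fun μ hμ ν hν => mconv_pExt hp hPsub hμ hν
  have hclosed : ∀ μ : Measure X, MemPp p μ →
        (∀ ε : ℝ, 0 < ε → ∃ ν ∈ pExt p P, dp μ ν < ε) → μ ∈ pExt p P := by
    intro μ hμ h
    have h' : ∀ n : ℕ, ∃ l : List (Measure X), l ≠ [] ∧ (∀ m ∈ l, m ∈ P) ∧
        dp μ (lconv l) < 1 / ((n : ℝ) + 1) := by
      intro n
      have hn : (0 : ℝ) < 1 / ((n : ℝ) + 1) / 2 := by positivity
      obtain ⟨ν, hν, h1⟩ := h _ hn
      obtain ⟨l, hl, hlP, h2⟩ := key P hPsub ν hν _ hn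
      refine ⟨l, hl, hlP, ?_⟩
      have hlp := memPp_lconv hp l fun μ h => hPsub μ (hlP μ h)
      rw [hdp] at h1 h2 ⊢
      have t1 := htriangle μ ν (lconv l) hμ.1 hν.1.1 hlp.1
      have t2 := abs_sub_le (∫ x, ‖x‖ ^ p ∂μ) (∫ x, ‖x‖ ^ p ∂ν) (∫ x, ‖x‖ ^ p ∂(lconv l))
      linarith
    choose l hl hlP hd using h'
    have hl' := fun j => memPp_lconv hp (l j) fun μ h => hPsub μ (hlP j μ h)
    have t0 := tendsto_one_div_add_atTop_nhds_zero_nat (𝕜 := ℝ)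
    have t1 : Tendsto (fun n => d0 (lconv (l n)) μ) atTop (𝓝 0) := by
      refine squeeze_zero (fun n => hnonneg _ _ (hl' n).1 hμ.1) (fun n => ?_) t0
      have := hd n
      rw [hdp] at this
      rw [hsymm _ _ (hl' n).1 hμ.1]
      linarith [abs_nonneg ((∫ x, ‖x‖ ^ p ∂μ) - ∫ x, ‖x‖ ^ p ∂(lconv (l n)))]
    have hw := (hmetrize μ _ hμ.1 (fun n => (hl' n).1)).1 t1
    have t2 : Tendsto (fun n => ∫ x, ‖x‖ ^ p ∂(lconv (l n))) atTop (𝓝 (∫ x, ‖x‖ ^ p ∂μ)) := by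
      rw [tendsto_iff_dist_tendsto_zero]
      refine squeeze_zero (fun n => dist_nonneg) (fun n => ?_) t0
      have := hd n
      rw [hdp] at this
      rw [dist_comm, Real.dist_eq]
      linarith [hnonneg _ _ hμ.1 (hl' n).1]
    exact mem_pExt.2 ⟨hμ, l, hl, hlP, hw, unifInt_of_moments hp hμ hl' hw t2⟩
  have hsmall : ∀ P Q : Set (Measure X), (∀ μ ∈ Q, MemPp p μ) → P ⊆ Q →
        (∀ μ ∈ Q, ∀ ν ∈ Q, mconv μ ν ∈ Q) →
        (∀ μ : Measure X, MemPp p μ →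
          (∀ ε : ℝ, 0 < ε → ∃ ν ∈ Q, dp μ ν < ε) → μ ∈ Q) →
        pExt p P ⊆ Q := by
    intro P Q hQ hPQ hc hcl μ hμ
    refine hcl μ hμ.1 fun ε hε => ?_
    obtain ⟨l, hl, hlP, h⟩ := key P (fun m hm => hQ m (hPQ hm)) μ hμ ε hε
    exact ⟨_, lconv_mem Q hQ hc l hl fun m hm => hPQ (hlP m hm), h⟩
  exact ⟨Subset.antisymm (hsmall _ _ hmem Subset.rfl hconv hclosed) (subset_pExt hmem), hmem,
    subset_pExt hPsub, hconv, hclosed, fun Q => hsmall P Q⟩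
end
end

section
/- Let X be a separable Banach space, p ∈ [2,∞), and let μ ∈ P_p(ℝ) satisfy ∫_ℝ r dμ(r) = 0 and σ² := ∫_ℝ r² dμ(r) ∈ (0,∞). Let γ ∈ P(ℝ) be the standard Gaussian law. Then P(γ,X) ⊆ (P(μ,X))_{p-ext}, where for ν ∈ P(ℝ) one defines P(ν,X) := { μ' ∈ P(X) : ∃ x ∈ X such that μ'(·) = ν({ r ∈ ℝ : r·x ∈ · }) }. -/
open MeasureTheory ProbabilityTheory Filter Set
open scoped ENNReal NNReal Topology

noncomputable section

/-- `P(ν,X)`: the set of laws of random variables of the form `φ • x` with `law φ = ν`. -/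
def Pscaled {X : Type*} [MeasurableSpace X] [NormedAddCommGroup X] [NormedSpace ℝ X]
    (ν : Measure ℝ) : Set (Measure X) :=
  {μ' | ∃ x : X, μ' = Measure.map (fun r : ℝ => r • x) ν}

lemma aux_tangent {q t : ℝ} (hq : 1 ≤ q) (ht : -1 < t) :
    (1 + t) ^ q ≤ 1 + q * t * (1 + t) ^ (q - 1) := by
  have h1 : 0 < 1 + t := by linarith
  have hs : -1 ≤ -t / (1 + t) := by
    rw [le_div_iff₀ h1]; linarith
  have hB := one_add_mul_self_le_rpow_one_add hs hq
  have he : 1 + -t / (1 + t) = (1 + t)⁻¹ := by field_simp; ring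
  rw [he, Real.inv_rpow h1.le] at hB
  have hpos : 0 < (1 + t) ^ q := Real.rpow_pos_of_pos h1 q
  have h2 := mul_le_mul_of_nonneg_left hB hpos.le
  rw [mul_inv_cancel₀ hpos.ne'] at h2
  have h3 : (1 + t) ^ q = (1 + t) ^ (q - 1) * (1 + t) := by
    rw [Real.rpow_sub_one h1.ne']; field_simp
  have h4 : (1 + t) ^ q * (1 + q * (-t / (1 + t))) = (1 + t) ^ q - q * t * (1 + t) ^ (q - 1) := by
    rw [h3]; field_simp
    ring
  linarith

lemma aux_one {p : ℝ} (hp : 2 ≤ p) : ∃ C : ℝ, 1 ≤ C ∧ ∀ t : ℝ,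
    |1 + t| ^ p ≤ 1 + p * t + C * (t ^ 2 + |t| ^ p) := by
  have h2p : (1 : ℝ) ≤ 2 ^ p := Real.one_le_rpow (by norm_num) (by linarith)
  refine ⟨2 ^ p * (p * p), by nlinarith [mul_le_mul hp hp (by norm_num) (by linarith)], fun t => ?_⟩
  have htp : 0 ≤ |t| ^ p := by positivity
  have hpp : 4 ≤ p * p := by nlinarith
  rcases le_or_gt |t| 1 with h | h
  · rw [abs_le] at h
    have hC : 0 ≤ 2 ^ p * (p * p) * |t| ^ p := by positivity
    rcases eq_or_lt_of_le h.1 with h0 | h0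
    · subst_vars
      norm_num
      rw [Real.zero_rpow (by linarith)]
      nlinarith
    have h1 : 0 < 1 + t := by linarith
    rw [abs_of_pos h1]
    have hT := aux_tangent (q := p) (by linarith) h0
    suffices hs : p * t * (1 + t) ^ (p - 1) ≤ p * t + 2 ^ p * (p * p) * t ^ 2 by
      rw [mul_add]; linarith
    rcases le_total 0 t with ht | ht
    · have hT2 := aux_tangent (q := p - 1) (by linarith) h0
      have hb : (1 + t) ^ (p - 1 - 1) ≤ 2 ^ p :=
        (Real.rpow_le_rpow h1.le (by linarith) (by linarith)).trans
          (Real.rpow_le_rpow_of_exponent_le (by norm_num) (by linarith))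
      have hpt : 0 ≤ p * t := by positivity
      calc p * t * (1 + t) ^ (p - 1) ≤ p * t * (1 + (p - 1) * t * (1 + t) ^ (p - 1 - 1)) := by gcongr
        _ ≤ p * t * (1 + p * t * 2 ^ p) := by
          have : 0 ≤ p - 1 := by linarith
          gcongr
          linarith
        _ = _ := by ring
    · have hT2 := one_add_mul_self_le_rpow_one_add h.1 (p := p - 1) (by linarith)
      have h5 := mul_le_mul_of_nonpos_left hT2 (show p * t ≤ 0 by nlinarith)
      have h6 : p * p * t ^ 2 ≤ 2 ^ p * (p * p) * t ^ 2 := by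
        nlinarith [mul_nonneg (show 0 ≤ p * p by positivity) (sq_nonneg t)]
      nlinarith [sq_nonneg t]
  · have h1 : |1 + t| ^ p ≤ 2 ^ p * |t| ^ p := by
      rw [← Real.mul_rpow (by norm_num) (abs_nonneg t)]
      apply Real.rpow_le_rpow (abs_nonneg _) _ (by linarith)
      have := abs_add_le 1 t
      simp at this
      linarith
    have h2 : |t| ≤ |t| ^ p := Real.self_le_rpow_of_one_le h.le (by linarith)
    have h3 := neg_abs_le t
    have h4 : -(p * |t| ^ p) ≤ p * t := by nlinarith
    have h5 : 0 ≤ 2 ^ p * (p * p) * t ^ 2 := by positivity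
    have h6 : (2 ^ p + p) * |t| ^ p ≤ 2 ^ p * (p * p) * |t| ^ p := by
      gcongr
      nlinarith
    nlinarith

lemma aux_two {p : ℝ} (hp : 2 ≤ p) : ∃ C : ℝ, 1 ≤ C ∧ ∀ a b : ℝ,
    |a + b| ^ p ≤ |a| ^ p + p * (|a| ^ (p - 2) * a) * b + C * (|a| ^ (p - 2) * b ^ 2 + |b| ^ p) := by
  obtain ⟨C, hC, h⟩ := aux_one hp
  refine ⟨C, hC, fun a b => ?_⟩
  rcases eq_or_ne a 0 with rfl | ha
  · simp only [zero_add, abs_zero, mul_zero, zero_mul, add_zero]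
    have h0 : 0 ≤ |b| ^ p := by positivity
    have h1 : (0 : ℝ) ≤ 0 ^ (p - 2) := Real.rpow_nonneg le_rfl _
    rw [Real.zero_rpow (by linarith : p ≠ 0)]
    have : 0 ≤ (0 : ℝ) ^ (p - 2) * b ^ 2 := by positivity
    nlinarith
  · have hap : 0 < |a| := abs_pos.2 ha
    have h1 := mul_le_mul_of_nonneg_left (h (b / a)) (show 0 ≤ |a| ^ p by positivity)
    have e1 : |a| ^ p * |1 + b / a| ^ p = |a + b| ^ p := by
      rw [← Real.mul_rpow (abs_nonneg _) (abs_nonneg _), ← abs_mul]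
      congr 2; field_simp
    have e2 : |a| ^ p = |a| ^ (p - 2) * a ^ 2 := by
      rw [← sq_abs a, ← Real.rpow_natCast, ← Real.rpow_add hap]
      norm_num
    have e3 : |a| ^ p * |b / a| ^ p = |b| ^ p := by
      rw [← Real.mul_rpow (abs_nonneg _) (abs_nonneg _), ← abs_mul]
      congr 2; field_simp
    rw [e1] at h1
    refine h1.trans (le_of_eq ?_)
    calc |a| ^ p * (1 + p * (b / a) + C * ((b / a) ^ 2 + |b / a| ^ p))
        = |a| ^ p + p * (|a| ^ p) * (b / a) + C * (|a| ^ p * (b / a) ^ 2 + |a| ^ p * |b / a| ^ p) := by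
          ring
      _ = _ := by
          rw [e3]
          nth_rewrite 2 3 [e2]
          field_simp

lemma aux_young {p x y : ℝ} (hp : 2 ≤ p) (hx : 0 ≤ x) (hy : 0 ≤ y) :
    x ^ (p - 2) * y ^ 2 ≤ x ^ p + y ^ p := by
  have key : ∀ z : ℝ, 0 ≤ z → z ^ (p - 2) * z ^ 2 = z ^ p := by
    intro z hz
    rw [← Real.rpow_natCast, ← Real.rpow_add_of_nonneg hz (by linarith) (by norm_num)]
    norm_num
  rcases le_total x y with h | h
  · have : x ^ (p - 2) * y ^ 2 ≤ y ^ (p - 2) * y ^ 2 := by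
      gcongr
    rw [key y hy] at this
    have : 0 ≤ x ^ p := by positivity
    linarith
  · have : x ^ (p - 2) * y ^ 2 ≤ x ^ (p - 2) * x ^ 2 := by gcongr
    rw [key x hx] at this
    have : 0 ≤ y ^ p := by positivity
    linarith

lemma aux_three {p : ℝ} (hp : 2 ≤ p) : ∃ D : ℝ, 1 ≤ D ∧ ∀ n : ℝ, 1 ≤ n → ∀ a b : ℝ,
    |a + b| ^ p ≤ |a| ^ p * (1 + 1 / (2 * n)) + p * (|a| ^ (p - 2) * a) * b
      + D * n ^ (p / 2 - 1) * |b| ^ p := by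
  obtain ⟨C, hC, h⟩ := aux_two hp
  refine ⟨(2 * C) ^ (p / 2) / 2 + C, ?_, fun n hn a b => (h a b).trans ?_⟩
  · have : 0 ≤ (2 * C) ^ (p / 2) := by positivity
    linarith
  have hy := aux_young (x := |a|) (y := √(2 * C * n) * |b|) hp (abs_nonneg _) (by positivity)
  have hsq : (√(2 * C * n)) ^ 2 = 2 * C * n := Real.sq_sqrt (by positivity)
  have hpw : (√(2 * C * n) * |b|) ^ p = (2 * C) ^ (p / 2) * (n ^ (p / 2 - 1) * n) * |b| ^ p := by
    rw [Real.mul_rpow (by positivity) (by positivity), Real.sqrt_eq_rpow,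
      ← Real.rpow_mul (by positivity), Real.mul_rpow (by positivity) (by positivity),
      ← Real.rpow_add_one (by positivity)]
    congr 3 <;> ring_nf
  rw [hpw, mul_pow, hsq, sq_abs] at hy
  have h1 : 1 ≤ n ^ (p / 2 - 1) := Real.one_le_rpow hn (by linarith)
  have hb : 0 ≤ |b| ^ p := by positivity
  have h2 : C * (|a| ^ (p - 2) * b ^ 2) ≤
      |a| ^ p * (1 / (2 * n)) + (2 * C) ^ (p / 2) / 2 * n ^ (p / 2 - 1) * |b| ^ p := by
    have hn0 : 0 < 2 * n := by linarith
    have := div_le_div_of_nonneg_right hy hn0.le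
    calc _ = |a| ^ (p - 2) * (2 * C * n * b ^ 2) / (2 * n) := by field_simp
      _ ≤ _ := this
      _ = _ := by field_simp
  have h3 : C * |b| ^ p ≤ C * n ^ (p / 2 - 1) * |b| ^ p := by
    have : C ≤ C * n ^ (p / 2 - 1) := le_mul_of_one_le_right (by linarith) h1
    gcongr
  linarith

lemma aux_moment {p : ℝ} (hp : 2 ≤ p) : ∃ A : ℝ, 1 ≤ A ∧
    ∀ (μ : Measure ℝ) [IsProbabilityMeasure μ] (f : ℝ → ℝ), Measurable f →
      MemLp f (ENNReal.ofReal p) μ → ∫ r, f r ∂μ = 0 → ∀ n : ℕ,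
      Integrable (fun ω : ℕ → ℝ => |∑ i ∈ Finset.range n, f (ω i)| ^ p)
        (Measure.infinitePi fun _ => μ) ∧
      ∫ ω, |∑ i ∈ Finset.range n, f (ω i)| ^ p ∂(Measure.infinitePi fun _ : ℕ => μ)
        ≤ A * (n : ℝ) ^ (p / 2) * ∫ r, |f r| ^ p ∂μ := by
  obtain ⟨D, hD, hineq⟩ := aux_three hp
  refine ⟨2 * D, by linarith, fun μ _ f hf hfp hf0 => ?_⟩
  set P : Measure (ℕ → ℝ) := Measure.infinitePi fun _ => μ with hP
  have hp0 : ENNReal.ofReal p ≠ 0 := by simp; linarith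
  have hptop : ENNReal.ofReal p ≠ ∞ := by simp
  have hpr : (ENNReal.ofReal p).toReal = p := ENNReal.toReal_ofReal (by linarith)
  have hmp : ∀ i, MeasurePreserving (Function.eval i) P μ :=
    fun i => measurePreserving_eval_infinitePi (fun _ : ℕ => μ) i
  have hmemi : ∀ i, MemLp (fun ω : ℕ → ℝ => f (ω i)) (ENNReal.ofReal p) P :=
    fun i => hfp.comp_measurePreserving (hmp i)
  have hmemS : ∀ n, MemLp (fun ω : ℕ → ℝ => ∑ i ∈ Finset.range n, f (ω i)) (ENNReal.ofReal p) P :=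
    fun n => memLp_finsetSum _ fun i _ => hmemi i
  have hint : ∀ g : (ℕ → ℝ) → ℝ, MemLp g (ENNReal.ofReal p) P →
      Integrable (fun ω => |g ω| ^ p) P := by
    intro g hg
    have := hg.integrable_norm_rpow hp0 hptop
    simpa [hpr] using this
  have hInd : iIndepFun (fun (i : ℕ) (ω : ℕ → ℝ) => f (ω i)) P :=
    iIndepFun_infinitePi (X := fun _ => f) (fun _ => hf)
  have hcomp : ∀ (g : ℝ → ℝ), Measurable g → ∀ i, ∫ ω, g (ω i) ∂P = ∫ r, g r ∂μ := by
    intro g hg i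
    rw [← (hmp i).map_eq, integral_map (measurable_pi_apply i).aemeasurable
      hg.aestronglyMeasurable]
  set m : ℝ := ∫ r, |f r| ^ p ∂μ with hm
  have hm0 : 0 ≤ m := integral_nonneg fun r => by positivity
  intro n
  refine ⟨hint _ (hmemS n), ?_⟩
  induction n with
  | zero =>
    simp only [Finset.range_zero, Finset.sum_empty, abs_zero, CharP.cast_eq_zero]
    rw [Real.zero_rpow (by linarith), Real.zero_rpow (by linarith)]
    simp
  | succ n ih =>
    have hlast : ∫ ω, |f (ω n)| ^ p ∂P = m := hcomp (fun r => |f r| ^ p) (by fun_prop) n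
    rcases Nat.eq_zero_or_pos n with h0 | hn
    · subst h0
      simp only [zero_add, Finset.range_one, Finset.sum_singleton, Nat.cast_one, Real.one_rpow]
      rw [hlast]
      nlinarith
    have hn1 : (1 : ℝ) ≤ n := by exact_mod_cast hn
    have hindn : IndepFun (fun ω : ℕ → ℝ => ∑ i ∈ Finset.range n, f (ω i)) (fun ω => f (ω n)) P := by
      have := hInd.indepFun_finsetSum_of_notMem (fun i => by fun_prop) (s := Finset.range n) (i := n)
        (by simp)
      convert this using 1
      ext ω; simp
    have hindn2 := hindn.comp (φ := fun a : ℝ => p * (|a| ^ (p - 2) * a)) (ψ := id)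
      (by fun_prop) measurable_id
    set S : (ℕ → ℝ) → ℝ := fun ω => ∑ i ∈ Finset.range n, f (ω i) with hS
    have hSm : Measurable S := by fun_prop
    have hcross0 : ∫ ω, p * (|S ω| ^ (p - 2) * S ω) * f (ω n) ∂P = 0 := by
      have := hindn2.integral_fun_mul_eq_mul_integral
        (Measurable.aestronglyMeasurable (by fun_prop)) (Measurable.aestronglyMeasurable (by fun_prop))
      simp only [Function.comp_apply, id] at this
      rw [this, hcomp f hf n, hf0, mul_zero]
    have hSi : Integrable (fun ω => |S ω| ^ p) P := hint _ (hmemS n)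
    have hfi := hint _ (hmemi n)
    have hcrossI : Integrable (fun ω => p * (|S ω| ^ (p - 2) * S ω) * f (ω n)) P := by
      refine ((hSi.add hfi).const_mul p).mono' (Measurable.aestronglyMeasurable (by fun_prop)) ?_
      refine ae_of_all _ fun ω => ?_
      rw [Real.norm_eq_abs, abs_mul, abs_mul, abs_mul, abs_of_nonneg (by linarith : 0 ≤ p),
        abs_of_nonneg (by positivity : 0 ≤ |S ω| ^ (p - 2)), mul_assoc]
      refine mul_le_mul_of_nonneg_left ?_ (by linarith)
      have key : ∀ z : ℝ, 0 ≤ z → z ^ (p - 2) * (z * z) = z ^ p := by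
        intro z hz
        rw [← sq, ← Real.rpow_natCast, ← Real.rpow_add_of_nonneg hz (by linarith) (by norm_num)]
        norm_num
      change |S ω| ^ (p - 2) * |S ω| * |f (ω n)| ≤ |S ω| ^ p + |f (ω n)| ^ p
      rw [mul_assoc]
      have ha := abs_nonneg (S ω)
      have hb := abs_nonneg (f (ω n))
      rcases le_total |S ω| |f (ω n)| with h | h
      · have : |S ω| ^ (p - 2) * (|S ω| * |f (ω n)|) ≤
            |f (ω n)| ^ (p - 2) * (|f (ω n)| * |f (ω n)|) := by
          gcongr
        rw [key _ hb] at this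
        have : 0 ≤ |S ω| ^ p := by positivity
        linarith
      · have : |S ω| ^ (p - 2) * (|S ω| * |f (ω n)|) ≤
            |S ω| ^ (p - 2) * (|S ω| * |S ω|) := by
          gcongr
        rw [key _ ha] at this
        have : 0 ≤ |f (ω n)| ^ p := by positivity
        linarith
    have hstep : ∫ ω, |∑ i ∈ Finset.range (n + 1), f (ω i)| ^ p ∂P ≤
        (∫ ω, |S ω| ^ p ∂P) * (1 + 1 / (2 * n)) + D * (n : ℝ) ^ (p / 2 - 1) * m := by
      calc _ ≤ ∫ ω, (|S ω| ^ p * (1 + 1 / (2 * n)) + p * (|S ω| ^ (p - 2) * S ω) * f (ω n)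
              + D * (n : ℝ) ^ (p / 2 - 1) * |f (ω n)| ^ p) ∂P := by
            refine integral_mono (hint _ (hmemS (n + 1)))
              (((hSi.mul_const _).add hcrossI).add (hfi.const_mul _)) fun ω => ?_
            simp only [Finset.sum_range_succ]
            exact hineq n hn1 (S ω) (f (ω n))
        _ = _ := by
            rw [integral_add (f := fun ω => |S ω| ^ p * (1 + 1 / (2 * (n : ℝ))) +
                p * (|S ω| ^ (p - 2) * S ω) * f (ω n))
                ((hSi.mul_const _).add hcrossI) (hfi.const_mul _),
              integral_add (hSi.mul_const _) hcrossI, hcross0, integral_mul_const,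
              integral_const_mul, hlast, add_zero]
    refine hstep.trans ?_
    have hnpos : (0 : ℝ) < n := by linarith
    have e1 : (n : ℝ) ^ (p / 2) = (n : ℝ) ^ (p / 2 - 1) * n := by
      rw [← Real.rpow_add_one hnpos.ne']; ring_nf
    have e2 : ((n : ℝ) + 1) ^ (p / 2) = ((n : ℝ) + 1) ^ (p / 2 - 1) * (n + 1) := by
      rw [← Real.rpow_add_one (by positivity)]; ring_nf
    have e3 : (n : ℝ) ^ (p / 2 - 1) ≤ ((n : ℝ) + 1) ^ (p / 2 - 1) :=
      Real.rpow_le_rpow hnpos.le (by linarith) (by linarith)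
    push_cast
    calc (∫ ω, |S ω| ^ p ∂P) * (1 + 1 / (2 * n)) + D * (n : ℝ) ^ (p / 2 - 1) * m
        ≤ (2 * D * (n : ℝ) ^ (p / 2) * m) * (1 + 1 / (2 * n)) + D * (n : ℝ) ^ (p / 2 - 1) * m := by
          gcongr
      _ = 2 * D * ((n : ℝ) ^ (p / 2 - 1) * (n + 1)) * m := by
          rw [e1]; field_simp; ring
      _ ≤ 2 * D * (((n : ℝ) + 1) ^ (p / 2 - 1) * (n + 1)) * m := by gcongr
      _ = _ := by rw [e2]

lemma aux_trunc {p : ℝ} (hp : 2 ≤ p) (μ : Measure ℝ) [IsProbabilityMeasure μ]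
    (hmomp : MemLp (fun r : ℝ => r) (ENNReal.ofReal p) μ) (h0 : ∫ r, r ∂μ = 0)
    {δ : ℝ} (hδ : 0 < δ) : ∃ f g : ℝ → ℝ, Measurable f ∧ Measurable g ∧
      (∀ r, f r + g r = r) ∧ (∃ B, ∀ r, |f r| ≤ B) ∧ MemLp g (ENNReal.ofReal p) μ ∧
      ∫ r, f r ∂μ = 0 ∧ ∫ r, g r ∂μ = 0 ∧ ∫ r, |g r| ^ p ∂μ < δ := by
  have hp0 : ENNReal.ofReal p ≠ 0 := by simp; linarith
  have hptop : ENNReal.ofReal p ≠ ∞ := by simp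
  have hpr : (ENNReal.ofReal p).toReal = p := ENNReal.toReal_ofReal (by linarith)
  have hid : Integrable (fun r : ℝ => r) μ :=
    hmomp.integrable (by rw [ENNReal.one_le_ofReal]; linarith)
  let T : ℕ → ℝ → ℝ := fun M => ({r : ℝ | |r| ≤ M}).indicator (fun r => r)
  have hms : ∀ M : ℕ, MeasurableSet {r : ℝ | |r| ≤ M} :=
    fun M => measurableSet_le (by fun_prop) (by fun_prop)
  have hTm : ∀ M, Measurable (T M) := fun M => Measurable.indicator measurable_id (hms M)
  have hTle : ∀ M r, |T M r| ≤ |r| := by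
    intro M r
    simp only [T, Set.indicator]; split_ifs <;> simp
  have hTlim : ∀ r, Tendsto (fun M => T M r) atTop (𝓝 r) := by
    intro r
    obtain ⟨N, hN⟩ := exists_nat_ge |r|
    refine tendsto_const_nhds.congr' ?_
    filter_upwards [eventually_ge_atTop N] with M hM
    have : |r| ≤ M := hN.trans (by exact_mod_cast hM)
    simp [T, this]
  let c : ℕ → ℝ := fun M => ∫ r, T M r ∂μ
  have hclim : Tendsto c atTop (𝓝 0) := by
    rw [← h0]
    exact tendsto_integral_of_dominated_convergence (fun r => |r|)
      (fun M => (hTm M).aestronglyMeasurable) hid.abs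
      (fun M => ae_of_all _ fun r => hTle M r) (ae_of_all _ hTlim)
  have hTi : ∀ M, Integrable (T M) μ := fun M =>
    hid.abs.mono' (hTm M).aestronglyMeasurable (ae_of_all _ fun r => hTle M r)
  let E : ℝ := ∫ r, |r| ∂μ
  have hcE : ∀ M, |c M| ≤ E := fun M =>
    (abs_integral_le_integral_abs).trans (integral_mono (hTi M).abs hid.abs (hTle M))
  have hbd : ∀ M r, |r - (T M r - c M)| ≤ ‖2 * |r| + E‖ := by
    intro M r
    rw [Real.norm_eq_abs]
    refine le_trans ?_ (le_abs_self _)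
    have h1 := abs_sub r (T M r - c M)
    have h2 := abs_sub (T M r) (c M)
    linarith [hTle M r, hcE M]
  have hdomL : MemLp (fun r : ℝ => 2 * |r| + E) (ENNReal.ofReal p) μ :=
    (hmomp.abs.const_mul 2).add (memLp_const E)
  have hgm : ∀ M, Measurable fun r => r - (T M r - c M) := fun M =>
    measurable_id.sub ((hTm M).sub_const _)
  have hlim : Tendsto (fun M => ∫ r, |r - (T M r - c M)| ^ p ∂μ) atTop (𝓝 0) := by
    have hz : ∫ r, (0 : ℝ) ∂μ = 0 := by simp
    rw [← hz]
    refine tendsto_integral_of_dominated_convergence (fun r => ‖2 * |r| + E‖ ^ p)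
      (fun M => ((hgm M).abs.pow_const p).aestronglyMeasurable) ?_ ?_ ?_
    · have := hdomL.integrable_norm_rpow hp0 hptop
      rwa [hpr] at this
    · refine fun M => ae_of_all _ fun r => ?_
      rw [Real.norm_eq_abs, abs_of_nonneg (by positivity)]
      exact Real.rpow_le_rpow (abs_nonneg _) (hbd M r) (by linarith)
    · refine ae_of_all _ fun r => ?_
      have h1 : Tendsto (fun M => |r - (T M r - c M)|) atTop (𝓝 0) := by
        have := (tendsto_const_nhds (x := r)).sub ((hTlim r).sub hclim)
        simpa using this.abs
      have := h1.rpow_const (p := p) (Or.inr (by linarith))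
      rwa [Real.zero_rpow (by linarith)] at this
  obtain ⟨M, hM⟩ := (hlim.eventually (gt_mem_nhds hδ)).exists
  have hf0 : ∫ r, (T M r - c M) ∂μ = 0 := by
    rw [integral_sub (hTi M) (integrable_const _)]
    simp [c]
  refine ⟨fun r => T M r - c M, fun r => r - (T M r - c M), (hTm M).sub_const _, hgm M,
    fun r => by ring, ⟨M + |c M|, fun r => ?_⟩, ?_, hf0, ?_, hM⟩
  · refine (abs_sub _ _).trans ?_
    gcongr
    simp only [T, Set.indicator]; split_ifs with h
    · exact h
    · simp
  · exact hdomL.mono (hgm M).aestronglyMeasurable (ae_of_all _ fun r => hbd M r)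
  · have := integral_sub hid ((hTi M).sub (integrable_const (c M)))
    simp only [Pi.sub_apply] at this
    rw [this, h0, hf0, sub_zero]

lemma aux_law {X : Type*} [MeasurableSpace X] [NormedAddCommGroup X] [NormedSpace ℝ X]
    [BorelSpace X] [SecondCountableTopology X] (μ : Measure ℝ) [IsProbabilityMeasure μ]
    (y : X) (n : ℕ) :
    finConv (fun _ : Fin n => Measure.map (fun r : ℝ => r • y) μ) =
      Measure.map (fun ω : ℕ → ℝ => (∑ i ∈ Finset.range n, ω i) • y)
        (Measure.infinitePi fun _ => μ) := by
  unfold finConv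
  rw [List.ofFn_const]
  have hInd : iIndepFun (fun (i : ℕ) (ω : ℕ → ℝ) => ω i) (Measure.infinitePi fun _ : ℕ => μ) :=
    iIndepFun_infinitePi (X := fun _ r => r) (fun _ => measurable_id)
  have hmy : Measurable fun r : ℝ => r • y := (continuous_id.smul continuous_const).measurable
  induction n with
  | zero => simp
  | succ n ih =>
    rw [List.replicate_succ, List.foldr_cons, ih]
    have hi : IndepFun (fun ω : ℕ → ℝ => (ω n) • y)
        (fun ω : ℕ → ℝ => (∑ i ∈ Finset.range n, ω i) • y) (Measure.infinitePi fun _ : ℕ => μ) := by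
      have := (hInd.indepFun_finsetSum_of_notMem (fun i => by fun_prop) (s := Finset.range n)
        (i := n) (by simp)).symm.comp (φ := fun r : ℝ => r • y) (ψ := fun r : ℝ => r • y) hmy hmy
      convert this using 1 <;> (funext ω; simp)
    have h1 := IndepFun.map_add_eq_map_conv_map (hmy.comp (measurable_pi_apply n))
      (hmy.comp (by fun_prop)) hi
    have h2 : Measure.map (fun ω : ℕ → ℝ => (ω n) • y) (Measure.infinitePi fun _ : ℕ => μ) =
        Measure.map (fun r : ℝ => r • y) μ := by
      have h3 := (measurePreserving_eval_infinitePi (fun _ : ℕ => μ) n).map_eq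
      calc _ = Measure.map (fun r : ℝ => r • y)
            (Measure.map (Function.eval n) (Measure.infinitePi fun _ : ℕ => μ)) :=
            (Measure.map_map hmy (measurable_pi_apply n)).symm
        _ = _ := by rw [h3]
    have h4 : Measure.map ((fun r : ℝ => r • y) ∘ fun ω : ℕ → ℝ => ω n)
        (Measure.infinitePi fun _ : ℕ => μ) = Measure.map (fun r : ℝ => r • y) μ := h2
    rw [h4] at h1
    unfold mconv
    unfold Measure.conv at h1
    refine h1.symm.trans ?_
    congr 1
    funext ω
    simp [Finset.sum_range_succ, add_smul, add_comm]

lemma aux_split {p K u v : ℝ} (hp : 0 < p) (hK : 0 < K) (h : K ≤ |u + v|) :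
    |u + v| ^ p ≤ 4 ^ p * (K ^ p)⁻¹ * |u| ^ (2 * p) + 2 ^ p * |v| ^ p := by
  have ht := abs_add_le u v
  have hu := abs_nonneg u
  have hv := abs_nonneg v
  rcases le_total |v| |u| with h1 | h1
  · have h2 : |u + v| ^ p ≤ (2 * |u|) ^ p :=
      Real.rpow_le_rpow (abs_nonneg _) (by linarith) hp.le
    have h3 : 1 ≤ (2 * |u| / K) ^ p :=
      Real.one_le_rpow (by rw [le_div_iff₀ hK]; linarith) hp.le
    have h4 : (2 * |u|) ^ p * (2 * |u| / K) ^ p = 4 ^ p * (K ^ p)⁻¹ * |u| ^ (2 * p) := by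
      rw [Real.div_rpow (by positivity) hK.le, Real.mul_rpow (by norm_num) hu, two_mul p,
        Real.rpow_add_of_nonneg hu hp.le hp.le, show (4 : ℝ) = 2 * 2 by norm_num,
        Real.mul_rpow (by norm_num) (by norm_num)]
      field_simp
    have h5 : 0 ≤ 2 ^ p * |v| ^ p := by positivity
    have h6 : 0 ≤ (2 * |u|) ^ p := by positivity
    nlinarith
  · have h2 : |u + v| ^ p ≤ (2 * |v|) ^ p :=
      Real.rpow_le_rpow (abs_nonneg _) (by linarith) hp.le
    rw [Real.mul_rpow (by norm_num) hv] at h2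
    have : 0 ≤ 4 ^ p * (K ^ p)⁻¹ * |u| ^ (2 * p) := by positivity
    linarith

lemma aux_ui {p : ℝ} (hp : 2 ≤ p) (μ : Measure ℝ) [IsProbabilityMeasure μ]
    (hmomp : MemLp (fun r : ℝ => r) (ENNReal.ofReal p) μ) (h0 : ∫ r, r ∂μ = 0)
    {c : ℝ} (hc : 0 ≤ c) {ε : ℝ} (hε : 0 < ε) : ∃ K : ℝ, ∀ n : ℕ, 0 < n →
      ∫ ω in {ω : ℕ → ℝ | K ≤ |c * (√n)⁻¹ * ∑ i ∈ Finset.range n, ω i|},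
        |c * (√n)⁻¹ * ∑ i ∈ Finset.range n, ω i| ^ p ∂(Measure.infinitePi fun _ : ℕ => μ) < ε := by
  obtain ⟨A, hA, hmomA⟩ := aux_moment hp
  obtain ⟨A', hA', hmomA'⟩ := aux_moment (p := 2 * p) (by linarith)
  have hcp : 0 ≤ c ^ p := by positivity
  set δ : ℝ := ε / 2 / (2 ^ p * (c ^ p + 1) * A) with hδ
  have hδ0 : 0 < δ := by positivity
  obtain ⟨f, g, hf, hg, hfg, ⟨B, hB⟩, hgp, hf0, hg0, hgδ⟩ := aux_trunc hp μ hmomp h0 hδ0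
  have hfL : MemLp f (ENNReal.ofReal (2 * p)) μ :=
    MemLp.of_bound hf.aestronglyMeasurable B (ae_of_all _ hB)
  set P : Measure (ℕ → ℝ) := Measure.infinitePi fun _ => μ with hP
  set F : ℝ := c ^ (2 * p) * A' * ∫ r, |f r| ^ (2 * p) ∂μ with hF
  have hF0 : 0 ≤ F := by
    have : 0 ≤ ∫ r, |f r| ^ (2 * p) ∂μ := integral_nonneg fun r => by positivity
    positivity
  obtain ⟨K, hK0, hK⟩ : ∃ K : ℝ, 0 < K ∧ 4 ^ p * (K ^ p)⁻¹ * F < ε / 2 := by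
    have : Tendsto (fun K : ℝ => 4 ^ p * (K ^ p)⁻¹ * F) atTop (𝓝 0) := by
      have := ((tendsto_rpow_atTop (y := p) (by linarith)).inv_tendsto_atTop.const_mul
        ((4 : ℝ) ^ p)).mul_const F
      simpa using this
    obtain ⟨K, h1, h2⟩ := ((this.eventually (gt_mem_nhds (half_pos hε))).and
      (eventually_gt_atTop 0)).exists
    exact ⟨K, h2, h1⟩
  refine ⟨K, fun n hn => ?_⟩
  have hnpos : (0 : ℝ) < n := by exact_mod_cast hn
  have hscale : ∀ q : ℝ, 0 < q → ∀ s : ℝ,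
      |c * (√n)⁻¹ * s| ^ q = c ^ q * ((n : ℝ) ^ (q / 2))⁻¹ * |s| ^ q := by
    intro q hq s
    rw [abs_mul, abs_of_nonneg (by positivity : 0 ≤ c * (√n)⁻¹),
      Real.mul_rpow (by positivity) (by positivity), Real.mul_rpow hc (by positivity),
      Real.inv_rpow (by positivity), Real.sqrt_eq_rpow, ← Real.rpow_mul hnpos.le]
    rw [show 1 / 2 * q = q / 2 by ring]
  have hscaleI : ∀ q : ℝ, 2 ≤ q → ∀ h : ℝ → ℝ, ∀ A : ℝ,
      Integrable (fun ω : ℕ → ℝ => |∑ i ∈ Finset.range n, h (ω i)| ^ q) P →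
      ∫ ω, |∑ i ∈ Finset.range n, h (ω i)| ^ q ∂P ≤ A * (n : ℝ) ^ (q / 2) * ∫ r, |h r| ^ q ∂μ →
      Integrable (fun ω : ℕ → ℝ => |c * (√n)⁻¹ * ∑ i ∈ Finset.range n, h (ω i)| ^ q) P ∧
      ∫ ω, |c * (√n)⁻¹ * ∑ i ∈ Finset.range n, h (ω i)| ^ q ∂P ≤
        c ^ q * A * ∫ r, |h r| ^ q ∂μ := by
    intro q hq h A hI hle
    simp_rw [hscale q (by linarith)]
    refine ⟨hI.const_mul _, ?_⟩
    rw [integral_const_mul]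
    calc _ ≤ c ^ q * ((n : ℝ) ^ (q / 2))⁻¹ * (A * (n : ℝ) ^ (q / 2) * ∫ r, |h r| ^ q ∂μ) := by
          gcongr
      _ = _ := by
          have : (n : ℝ) ^ (q / 2) ≠ 0 := (Real.rpow_pos_of_pos hnpos _).ne'
          field_simp
  obtain ⟨hUI, hUle⟩ := hscaleI (2 * p) (by linarith) f A' (hmomA' μ f hf hfL hf0 n).1
    (hmomA' μ f hf hfL hf0 n).2
  obtain ⟨hVI, hVle⟩ := hscaleI p hp g A (hmomA μ g hg hgp hg0 n).1 (hmomA μ g hg hgp hg0 n).2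
  have hsum : ∀ ω : ℕ → ℝ, c * (√n)⁻¹ * ∑ i ∈ Finset.range n, ω i =
      c * (√n)⁻¹ * ∑ i ∈ Finset.range n, f (ω i) + c * (√n)⁻¹ * ∑ i ∈ Finset.range n, g (ω i) := by
    intro ω
    rw [← mul_add, ← Finset.sum_add_distrib]
    exact congrArg _ (Finset.sum_congr rfl fun i _ => (hfg (ω i)).symm)
  set U : (ℕ → ℝ) → ℝ := fun ω => c * (√n)⁻¹ * ∑ i ∈ Finset.range n, f (ω i) with hU
  set V : (ℕ → ℝ) → ℝ := fun ω => c * (√n)⁻¹ * ∑ i ∈ Finset.range n, g (ω i) with hV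
  have hW := funext hsum
  set W : (ℕ → ℝ) → ℝ := fun ω => c * (√n)⁻¹ * ∑ i ∈ Finset.range n, ω i with hWdef
  change W = fun ω => U ω + V ω at hW
  change ∫ ω in {ω | K ≤ |W ω|}, |W ω| ^ p ∂P < ε
  rw [hW]
  have hUm : Measurable U := by fun_prop
  have hVm : Measurable V := by fun_prop
  have hms : MeasurableSet {ω | K ≤ |U ω + V ω|} := measurableSet_le (by fun_prop) (by fun_prop)
  have hRI : Integrable (fun ω => 4 ^ p * (K ^ p)⁻¹ * |U ω| ^ (2 * p) + 2 ^ p * |V ω| ^ p) P :=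
    (hUI.const_mul _).add (hVI.const_mul _)
  have hgoal : ∫ ω in {ω | K ≤ |U ω + V ω|}, |U ω + V ω| ^ p ∂P ≤
      4 ^ p * (K ^ p)⁻¹ * ∫ ω, |U ω| ^ (2 * p) ∂P + 2 ^ p * ∫ ω, |V ω| ^ p ∂P := by
    rw [← integral_indicator hms, ← integral_const_mul, ← integral_const_mul,
      ← integral_add (hUI.const_mul _) (hVI.const_mul _)]
    refine integral_mono_of_nonneg (ae_of_all _ fun ω => ?_) hRI (ae_of_all _ fun ω => ?_)
    · exact Set.indicator_nonneg (fun _ _ => by positivity) ω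
    · by_cases h : ω ∈ {ω | K ≤ |U ω + V ω|}
      · simp only [Set.indicator_of_mem h]
        exact aux_split (by linarith) hK0 h
      · simp only [Set.indicator_of_notMem h]
        positivity
  have hg0' : 0 ≤ ∫ r, |g r| ^ p ∂μ := integral_nonneg fun r => by positivity
  have h1 : 4 ^ p * (K ^ p)⁻¹ * ∫ ω, |U ω| ^ (2 * p) ∂P < ε / 2 :=
    lt_of_le_of_lt (by gcongr) hK
  have h2 : 2 ^ p * ∫ ω, |V ω| ^ p ∂P ≤ ε / 2 := by
    calc _ ≤ 2 ^ p * (c ^ p * A * ∫ r, |g r| ^ p ∂μ) := by gcongr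
      _ ≤ 2 ^ p * ((c ^ p + 1) * A * δ) := by gcongr; linarith
      _ = ε / 2 := by rw [hδ]; field_simp
  linarith

/-- For a mean-zero `μ ∈ P_p(ℝ)` (`p ≥ 2`) with positive finite variance, the Gaussian
one-dimensional laws belong to the `p`-extension of the `μ`-one-dimensional laws. -/
theorem gaussian_laws_mem_pExt
    {X : Type*} [MeasurableSpace X] [NormedAddCommGroup X] [NormedSpace ℝ X]
    [BorelSpace X] [TopologicalSpace.SeparableSpace X] [CompleteSpace X]
    (p : ℝ) (hp : 2 ≤ p)
    (μ : Measure ℝ) [IsProbabilityMeasure μ]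
    (hmomp : Integrable (fun r : ℝ => |r| ^ p) μ)
    (hmean : Integrable (fun r : ℝ => r) μ) (hmean0 : ∫ r, r ∂μ = 0)
    (hvar : Integrable (fun r : ℝ => r ^ 2) μ) (hvarpos : 0 < ∫ r, r ^ 2 ∂μ) :
    Pscaled (X := X) (gaussianReal 0 1) ⊆ pExt p (Pscaled (X := X) μ) := by
  have : SecondCountableTopology X := UniformSpace.secondCountable_of_separable X
  rintro _ ⟨x, rfl⟩
  have hp0 : ENNReal.ofReal p ≠ 0 := by simp; linarith
  have hptop : ENNReal.ofReal p ≠ ∞ := by simp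
  have hpr : (ENNReal.ofReal p).toReal = p := ENNReal.toReal_ofReal (by linarith)
  have hcx : ∀ x : X, Continuous fun r : ℝ => r • x := fun x => continuous_id.smul continuous_const
  have hmx : ∀ x : X, Measurable fun r : ℝ => r • x := fun x => (hcx x).measurable
  have hnp : Measurable fun z : X => ‖z‖ ^ p := measurable_norm.pow_const p
  have hL : MemLp (fun r : ℝ => r) (ENNReal.ofReal p) μ := by
    refine (integrable_norm_rpow_iff (f := fun r : ℝ => r) measurable_id.aestronglyMeasurable
      hp0 hptop).1 ?_
    rw [hpr]
    exact hmomp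
  set P : Measure (ℕ → ℝ) := Measure.infinitePi fun _ => μ with hP
  set σ : ℝ := √(∫ r, r ^ 2 ∂μ) with hσ
  have hσ0 : 0 < σ := Real.sqrt_pos.2 hvarpos
  have hσ2 : σ ^ 2 = ∫ r, r ^ 2 ∂μ := Real.sq_sqrt hvarpos.le
  have hlaw := fun j : ℕ => aux_law μ (((√((j + 1 : ℕ) : ℝ))⁻¹ * σ⁻¹) • x) (j + 1)
  have hSm : ∀ n, Measurable fun ω : ℕ → ℝ => ∑ i ∈ Finset.range n, ω i := fun n => by fun_prop
  have hSx : ∀ n, ∀ y : X, Measurable fun ω : ℕ → ℝ => (∑ i ∈ Finset.range n, ω i) • y :=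
    fun n y => (hmx y).comp (hSm n)
  refine ⟨⟨Measure.isProbabilityMeasure_map (hmx x).aemeasurable, ?_⟩, fun j => j + 1,
    fun j _ => Measure.map (fun r : ℝ => r • (((√((j + 1 : ℕ) : ℝ))⁻¹ * σ⁻¹) • x)) μ,
    fun j => Nat.succ_pos j, fun j _ => ⟨_, rfl⟩, ?_, ?_⟩
  · rw [integrable_map_measure hnp.aestronglyMeasurable (hmx x).aemeasurable]
    have h1 := (memLp_id_gaussianReal' (μ := 0) (v := 1) (ENNReal.ofReal p)
      hptop).integrable_norm_rpow hp0 hptop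
    rw [hpr] at h1
    refine (h1.mul_const (‖x‖ ^ p)).congr (ae_of_all _ fun r => ?_)
    simp only [Function.comp_apply, id, norm_smul]
    rw [Real.mul_rpow (norm_nonneg _) (norm_nonneg _)]
  · intro f
    have hInd : iIndepFun (fun (i : ℕ) (ω : ℕ → ℝ) => ω i / σ) P :=
      iIndepFun_infinitePi (X := fun _ r => r / σ) (fun _ => by fun_prop)
    have hmp : ∀ i, MeasurePreserving (Function.eval i) P μ :=
      fun i => measurePreserving_eval_infinitePi (fun _ : ℕ => μ) i
    have hcomp : ∀ (g : ℝ → ℝ), Measurable g → ∀ i, ∫ ω, g (ω i) ∂P = ∫ r, g r ∂μ := by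
      intro g hg i
      rw [← (hmp i).map_eq, integral_map (measurable_pi_apply i).aemeasurable
        hg.aestronglyMeasurable]
    have hY : HasLaw (id : ℝ → ℝ) (gaussianReal 0 1) (gaussianReal 0 1) :=
      ⟨aemeasurable_id, Measure.map_id⟩
    have hclt := tendstoInDistribution_inv_sqrt_mul_sum (P := P)
      (X := fun (i : ℕ) (ω : ℕ → ℝ) => ω i / σ) hY ?_ ?_ hInd ?_
    · have h1 := (ProbabilityMeasure.tendsto_iff_forall_integral_tendsto.1 hclt.tendsto
        (f.compContinuous ⟨fun r : ℝ => r • x, hcx x⟩)).comp (tendsto_add_atTop_nat 1)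
      have hfx : Measurable fun r : ℝ => f (r • x) := (f.continuous.comp (hcx x)).measurable
      rw [integral_map (hmx x).aemeasurable f.continuous.measurable.aestronglyMeasurable]
      have h1' : Tendsto (fun j : ℕ => ∫ r, f (r • x) ∂(P.map
          (fun ω => (√((j + 1 : ℕ) : ℝ))⁻¹ * ∑ k ∈ Finset.range (j + 1), ω k / σ))) atTop
          (𝓝 (∫ r, f (r • x) ∂(Measure.map id (gaussianReal 0 1)))) := h1
      rw [Measure.map_id] at h1'
      refine h1'.congr fun j => ?_
      symm
      beta_reduce
      rw [hlaw, integral_map (hSx _ _).aemeasurable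
        f.continuous.measurable.aestronglyMeasurable,
        integral_map (Measurable.aemeasurable (by fun_prop)) hfx.aestronglyMeasurable]
      refine integral_congr_ae (ae_of_all _ fun ω => ?_)
      simp only [smul_smul, ← Finset.sum_div]
      congr 2
      field_simp
    · rw [hcomp (fun r => r / σ) (by fun_prop), integral_div, hmean0, zero_div]
    · have := hcomp (fun r => (r / σ) ^ 2) (by fun_prop) 0
      simp only [Pi.pow_apply]
      rw [this]
      simp_rw [div_pow]
      rw [integral_div, ← hσ2, div_self (by positivity)]
    · intro i
      have h : IdentDistrib (fun ω : ℕ → ℝ => ω i) (fun ω => ω 0) P P :=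
        ⟨(measurable_pi_apply i).aemeasurable, (measurable_pi_apply 0).aemeasurable,
          (hmp i).map_eq.trans (hmp 0).map_eq.symm⟩
      exact h.comp (u := fun r => r / σ) (by fun_prop)
  · intro ε hε
    obtain ⟨K, hK⟩ := aux_ui hp μ hL hmean0 (c := ‖x‖ * σ⁻¹) (by positivity) hε
    refine ⟨K, fun j => ?_⟩
    have hKj := hK (j + 1) (Nat.succ_pos j)
    have hms : MeasurableSet {z : X | K ≤ ‖z‖} :=
      measurableSet_le measurable_const measurable_norm
    have he : ∀ ω : ℕ → ℝ,
        ‖(∑ i ∈ Finset.range (j + 1), ω i) • (((√((j + 1 : ℕ) : ℝ))⁻¹ * σ⁻¹) • x)‖ =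
        |‖x‖ * σ⁻¹ * (√((j + 1 : ℕ) : ℝ))⁻¹ * ∑ i ∈ Finset.range (j + 1), ω i| := by
      intro ω
      rw [norm_smul, norm_smul, Real.norm_eq_abs, Real.norm_eq_abs, abs_mul, abs_mul, abs_mul,
        abs_mul, abs_norm]
      ring
    beta_reduce
    rw [hlaw, setIntegral_map hms hnp.aestronglyMeasurable (hSx _ _).aemeasurable]
    simp only [Set.preimage_setOf_eq, he]
    exact hKj
end
end

section
/- Let c₀ be the Banach space of real sequences converging to 0 with the supremum norm, and let D_{√log} : c₀ → c₀ be the bounded diagonal operator D_{√log}((ξ_k)_{k=1}^∞) := (ξ_k/√(1+log k))_{k=1}^∞. Then D₂(D_{√log}) < ∞, i.e., there exists c ∈ (0,∞) such that for every N ≥ 2, every v₀ ∈ c₀ and every choice of functions f_n : {−1,1}^n → c₀ (n = 1,…,N−1), setting v_n := f_n(r₁,…,r_n), one has ‖Σ_{n=1}^N r_n D_{√log} v_{n−1}‖_{L²(ℙ;c₀)} ≤ c ‖Σ_{n=1}^N r'_n v_{n−1}‖_{L²(ℙ⊗ℙ';c₀)}, where (r_n)_{n=1}^N is a Rademacher sequence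 and (r'_n)_{n=1}^N is an independent copy of it on an independent probability space. -/
open MeasureTheory ProbabilityTheory Filter Set
open scoped ENNReal NNReal Topology

noncomputable section

/-- The uniform measure on `Bool` (a fair coin). -/
def unifBool : Measure Bool :=
  (2 : ℝ≥0∞)⁻¹ • Measure.dirac true + (2 : ℝ≥0∞)⁻¹ • Measure.dirac false

instance : IsProbabilityMeasure unifBool := by
  constructor
  simp [unifBool, ENNReal.inv_two_add_inv_two]

/-- The canonical probability space of `N` independent fair coins. -/
def bern (N : ℕ) : Measure (Fin N → Bool) := Measure.pi fun _ => unifBool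

instance (N : ℕ) : IsProbabilityMeasure (bern N) := by
  unfold bern; infer_instance

/-- The Rademacher variable associated to a coin flip. -/
def rad (b : Bool) : ℝ := if b then 1 else -1

/-- `v n` depends only on the first `n` coordinates, i.e. `v n = f n (r 1, …, r n)`. -/
def DyadicAdapted {X : Type*} {N : ℕ} (v : ℕ → (Fin N → Bool) → X) : Prop :=
  ∀ (n : ℕ) (ω ω' : Fin N → Bool), (∀ i : Fin N, (i : ℕ) < n → ω i = ω' i) → v n ω = v n ω'

/-- `c` is an upper decoupling constant for `X`-valued dyadic martingales in `L^p`. -/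
def DecIneq (p : ℝ) (X : Type*) [NormedAddCommGroup X] [NormedSpace ℝ X] (c : ℝ≥0∞) : Prop :=
  ∀ N : ℕ, 2 ≤ N → ∀ v : ℕ → (Fin N → Bool) → X, DyadicAdapted v →
    eLpNorm (fun ω => ∑ n : Fin N, rad (ω n) • v (n : ℕ) ω) (ENNReal.ofReal p) (bern N) ≤
      c * eLpNorm (fun z : (Fin N → Bool) × (Fin N → Bool) =>
        ∑ n : Fin N, rad (z.2 n) • v (n : ℕ) z.1) (ENNReal.ofReal p) ((bern N).prod (bern N))

/-- The dyadic decoupling constant `D_p(X) ∈ [0,∞]`. -/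
def Dp (p : ℝ) (X : Type*) [NormedAddCommGroup X] [NormedSpace ℝ X] : ℝ≥0∞ :=
  sInf {c : ℝ≥0∞ | DecIneq p X c}

open scoped ZeroAtInfty

/-- The diagonal operator `D_{√log}` on `c₀`, dividing the `k`-th coordinate (`k = 1, 2, …`,
here indexed by `k+1` for `k : ℕ`) by `√(1 + log k)`. -/
def Dlog (f : C₀(ℕ, ℝ)) : C₀(ℕ, ℝ) where
  toFun := fun k => f k / Real.sqrt (1 + Real.log (k + 1))
  continuous_toFun := continuous_of_discreteTopology
  zero_at_infty' := by
    have h0 : Tendsto (fun k => ‖f k‖) (cocompact ℕ) (𝓝 0) := by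
      simpa using f.zero_at_infty'.norm
    refine squeeze_zero_norm (fun k => ?_) h0
    have h1 : (1 : ℝ) ≤ Real.sqrt (1 + Real.log (k + 1)) := by
      have hk : (0 : ℝ) ≤ (k : ℝ) := Nat.cast_nonneg k
      have hlog : (0 : ℝ) ≤ Real.log ((k : ℝ) + 1) := Real.log_nonneg (by linarith)
      calc (1 : ℝ) = Real.sqrt 1 := by simp
        _ ≤ Real.sqrt (1 + Real.log (k + 1)) := Real.sqrt_le_sqrt (by linarith)
    have h2 : (0 : ℝ) < Real.sqrt (1 + Real.log (k + 1)) := lt_of_lt_of_le one_pos h1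
    calc ‖f k / Real.sqrt (1 + Real.log (k + 1))‖
        = |f k| / Real.sqrt (1 + Real.log (k + 1)) := by
          rw [Real.norm_eq_abs, abs_div, abs_of_pos h2]
      _ ≤ |f k| := div_le_self (abs_nonneg _) h1
      _ = ‖f k‖ := (Real.norm_eq_abs _).symm

lemma weighted_step (x w : ℝ) :
    (1 + w ^ 2) * (Real.exp ((x + w) ^ 2 / (4 * (1 + w ^ 2)))
      + Real.exp ((x - w) ^ 2 / (4 * (1 + w ^ 2)))) ≤
    2 * (Real.exp (x ^ 2 / 4) + Real.exp (3 / 2) * w ^ 2) := by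
  have hpos : 0 < 1 + w ^ 2 := by positivity
  set q : ℝ := w ^ 2 / (1 + w ^ 2) with hq
  have hq0 : 0 ≤ q := by positivity
  have hq1 : q ≤ 1 := by rw [hq, div_le_one hpos]; linarith
  have hp : (1 + w ^ 2) * (1 - q) = 1 := by rw [hq]; field_simp; ring
  have hqw : (1 + w ^ 2) * q = w ^ 2 := by rw [hq]; field_simp
  have e1 : Real.exp ((x + w) ^ 2 / (4 * (1 + w ^ 2)))
      + Real.exp ((x - w) ^ 2 / (4 * (1 + w ^ 2)))
      = 2 * (Real.exp ((x ^ 2 + w ^ 2) / (4 * (1 + w ^ 2))) *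
          Real.cosh (x * w / (2 * (1 + w ^ 2)))) := by
    rw [Real.cosh_eq]
    have a1 : (x + w) ^ 2 / (4 * (1 + w ^ 2)) =
      (x ^ 2 + w ^ 2) / (4 * (1 + w ^ 2)) + x * w / (2 * (1 + w ^ 2)) := by
      field_simp; ring
    have a2 : (x - w) ^ 2 / (4 * (1 + w ^ 2)) =
      (x ^ 2 + w ^ 2) / (4 * (1 + w ^ 2)) + -(x * w / (2 * (1 + w ^ 2))) := by
      field_simp; ring
    rw [a1, a2, Real.exp_add, Real.exp_add]; ring
  have e2 : Real.exp ((x ^ 2 + w ^ 2) / (4 * (1 + w ^ 2))) *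
          Real.cosh (x * w / (2 * (1 + w ^ 2))) ≤
      Real.exp ((1 - q / 2 - q ^ 2 / 2) * (x ^ 2 / 4) + q / 4) := by
    calc _ ≤ Real.exp ((x ^ 2 + w ^ 2) / (4 * (1 + w ^ 2))) *
          Real.exp ((x * w / (2 * (1 + w ^ 2))) ^ 2 / 2) := by
          gcongr; exact Real.cosh_le_exp_half_sq _
      _ = _ := by
          rw [← Real.exp_add]; congr 1; rw [hq]; field_simp; ring
  have e3 : Real.exp ((1 - q / 2 - q ^ 2 / 2) * (x ^ 2 / 4) + q / 4) ≤
      (1 - q) * Real.exp (x ^ 2 / 4) + q * Real.exp (3 / 2) := by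
    set m : ℝ := 1 - q / 2 - q ^ 2 / 2 with hm
    have hm0 : 0 ≤ m := by nlinarith
    have hm1 : 0 ≤ 1 - m := by nlinarith
    have hmq : 1 - m ≤ q := by nlinarith
    have c := convexOn_exp.2 (mem_univ (x ^ 2 / 4 - q / 2)) (mem_univ (3 / 2 : ℝ)) hm0 hm1
      (by ring)
    simp only [smul_eq_mul] at c
    have hexp : m * (x ^ 2 / 4) + q / 4 ≤ m * (x ^ 2 / 4 - q / 2) + (1 - m) * (3 / 2) := by
      have : q / 4 + m * (q / 2) ≤ (1 - m) * (3 / 2) := by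
        rw [hm]; nlinarith [mul_nonneg hq0 hq0, mul_nonneg hq0 (mul_nonneg hq0 hq0)]
      linarith
    have h1 : m * Real.exp (x ^ 2 / 4 - q / 2) ≤ (1 - q) * Real.exp (x ^ 2 / 4) := by
      rw [Real.exp_sub]
      have : 1 + q / 2 ≤ Real.exp (q / 2) := by linarith [Real.add_one_le_exp (q / 2)]
      have hE := Real.exp_pos (q / 2)
      have hm' : m ≤ (1 - q) * Real.exp (q / 2) := by
        have : (1 - q) * (1 + q / 2) ≤ (1 - q) * Real.exp (q / 2) := by
          apply mul_le_mul_of_nonneg_left this; linarith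
        rw [hm]; nlinarith
      rw [mul_div_assoc', div_le_iff₀ hE]
      nlinarith [Real.exp_pos (x ^ 2 / 4)]
    have h2 : (1 - m) * Real.exp (3 / 2) ≤ q * Real.exp (3 / 2) := by gcongr
    calc _ ≤ _ := Real.exp_le_exp.2 hexp
      _ ≤ _ := c
      _ ≤ _ := add_le_add h1 h2
  rw [e1]
  have := mul_le_mul_of_nonneg_left (e2.trans e3) hpos.le
  have h4 : (1 + w ^ 2) * ((1 - q) * Real.exp (x ^ 2 / 4) + q * Real.exp (3 / 2)) =
      Real.exp (x ^ 2 / 4) + Real.exp (3 / 2) * w ^ 2 := by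
    rw [mul_add, ← mul_assoc, ← mul_assoc, hp, hqw]; ring
  linarith

/-- The Bellman function. -/
def UU (x t : ℝ) : ℝ := t * Real.exp (x ^ 2 / (4 * t)) - Real.exp (3 / 2) * t

lemma UU_step (x t w : ℝ) (ht : 0 ≤ t) (h0 : t = 0 → x = 0) :
    UU (x + w) (t + w ^ 2) + UU (x - w) (t + w ^ 2) ≤ 2 * UU x t := by
  unfold UU
  rcases ht.eq_or_lt with h | h
  · have hx := h0 h.symm
    subst hx; rw [← h]
    by_cases hw : w = 0
    · simp [hw]
    · have a1 : (0 + w) ^ 2 / (4 * (0 + w ^ 2)) = 1 / 4 := by field_simp; ring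
      have a2 : (0 - w) ^ 2 / (4 * (0 + w ^ 2)) = 1 / 4 := by field_simp; ring
      rw [a1, a2]
      have : Real.exp (1 / 4) ≤ Real.exp (3 / 2) := Real.exp_le_exp.2 (by norm_num)
      nlinarith [sq_nonneg w]
  · obtain ⟨s, hs, rfl⟩ : ∃ s : ℝ, 0 < s ∧ t = s ^ 2 :=
      ⟨Real.sqrt t, Real.sqrt_pos.2 h, (Real.sq_sqrt ht).symm⟩
    have k := mul_le_mul_of_nonneg_left (weighted_step (x / s) (w / s)) (sq_nonneg s)
    have b1 : (x / s + w / s) ^ 2 / (4 * (1 + (w / s) ^ 2)) =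
        (x + w) ^ 2 / (4 * (s ^ 2 + w ^ 2)) := by field_simp
    have b2 : (x / s - w / s) ^ 2 / (4 * (1 + (w / s) ^ 2)) =
        (x - w) ^ 2 / (4 * (s ^ 2 + w ^ 2)) := by field_simp
    have b3 : (x / s) ^ 2 / 4 = x ^ 2 / (4 * s ^ 2) := by field_simp
    rw [b1, b2, b3] at k
    have b4 : s ^ 2 * (w / s) ^ 2 = w ^ 2 := by field_simp
    rw [← mul_assoc] at k
    have b5 : s ^ 2 * (1 + (w / s) ^ 2) = s ^ 2 + w ^ 2 := by rw [mul_add, b4]; ring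
    rw [b5] at k
    have b6 : s ^ 2 * (2 * (Real.exp (x ^ 2 / (4 * s ^ 2)) + Real.exp (3 / 2) * (w / s) ^ 2)) =
      2 * (s ^ 2 * Real.exp (x ^ 2 / (4 * s ^ 2)) + Real.exp (3 / 2) * w ^ 2) := by
      rw [← b4]; ring
    rw [b6] at k
    nlinarith

lemma bellman {N : ℕ} (v : ℕ → (Fin N → Bool) → ℝ) (hv : DyadicAdapted v) (U : ℝ → ℝ → ℝ)
    (hU : ∀ x t w : ℝ, 0 ≤ t → (t = 0 → x = 0) →
      U (x + w) (t + w ^ 2) + U (x - w) (t + w ^ 2) ≤ 2 * U x t) (h00 : U 0 0 ≤ 0) :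
    ∑ ω : Fin N → Bool, U (∑ n : Fin N, rad (ω n) * v n ω) (∑ n : Fin N, (v n ω) ^ 2) ≤ 0 := by
  let X : ℕ → (Fin N → Bool) → ℝ := fun n ω =>
    ∑ i : Fin N, if (i : ℕ) < n then rad (ω i) * v i ω else 0
  let T : ℕ → (Fin N → Bool) → ℝ := fun n ω =>
    ∑ i : Fin N, if (i : ℕ) < n then (v i ω) ^ 2 else 0
  have key : ∀ n, n ≤ N → ∑ ω, U (X n ω) (T n ω) ≤ 0 := by
    intro n
    induction n with
    | zero => intro _; simp [X, T]; exact mul_nonpos_of_nonneg_of_nonpos (by positivity) h00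
    | succ n ih =>
      intro hn
      have hn' : n < N := hn
      let j : Fin N := ⟨n, hn'⟩
      have split : ∀ g : Fin N → ℝ, (∑ i : Fin N, if (i : ℕ) < n + 1 then g i else 0) =
          (∑ i : Fin N, if (i : ℕ) < n then g i else 0) + g j := by
        intro g
        have : g j = ∑ i : Fin N, if i = j then g i else 0 := by simp
        rw [this, ← Finset.sum_add_distrib]
        refine Finset.sum_congr rfl fun i _ => ?_
        have hij : i = j ↔ (i : ℕ) = n := by simp [j, Fin.ext_iff]
        by_cases h1 : (i : ℕ) < n
        · have : ¬ i = j := by rw [hij]; omega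
          simp [h1, this, Nat.lt_succ_of_lt h1]
        · by_cases h2 : i = j
          · have := hij.1 h2
            rw [if_pos (by omega), if_neg h1, if_pos h2, zero_add]
          · have : ¬ (i : ℕ) < n + 1 := by rw [hij] at h2; omega
            simp [h1, h2, this]
      let fl : (Fin N → Bool) → (Fin N → Bool) := fun ω => Function.update ω j (!ω j)
      have hinv : Function.Involutive fl := by
        intro ω; simp [fl]
      have hfl : ∀ ω, ∀ i : Fin N, (i : ℕ) < n → fl ω i = ω i := by
        intro ω i hi
        have : i ≠ j := by intro h; rw [h] at hi; simp [j] at hi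
        simp [fl, this]
      have hvfl : ∀ ω, ∀ m : ℕ, m ≤ n → v m (fl ω) = v m ω := by
        intro ω m hm
        exact hv m _ _ fun i hi => hfl ω i (by omega)
      have hX : ∀ ω, X n (fl ω) = X n ω := by
        intro ω
        refine Finset.sum_congr rfl fun i _ => ?_
        split_ifs with hi
        · rw [hfl ω i hi, hvfl ω i hi.le]
        · rfl
      have hT : ∀ ω, T n (fl ω) = T n ω := by
        intro ω
        refine Finset.sum_congr rfl fun i _ => ?_
        split_ifs with hi
        · rw [hvfl ω i hi.le]
        · rfl
      have hX1 : ∀ ω, X (n + 1) ω = X n ω + rad (ω j) * v n ω := fun ω => split _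
      have hT1 : ∀ ω, T (n + 1) ω = T n ω + (v n ω) ^ 2 := fun ω => split _
      have hsum : ∑ ω, U (X (n + 1) (fl ω)) (T (n + 1) (fl ω)) =
          ∑ ω, U (X (n + 1) ω) (T (n + 1) ω) :=
        Equiv.sum_comp (hinv.toPerm fl) (fun ω => U (X (n + 1) ω) (T (n + 1) ω))
      have hpt : ∀ ω, U (X (n + 1) ω) (T (n + 1) ω) + U (X (n + 1) (fl ω)) (T (n + 1) (fl ω)) ≤
          2 * U (X n ω) (T n ω) := by
        intro ω
        have hTn : 0 ≤ T n ω := Finset.sum_nonneg fun i _ => by split_ifs <;> positivity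
        have hz : T n ω = 0 → X n ω = 0 := by
          intro h
          have := (Finset.sum_eq_zero_iff_of_nonneg
            (fun i _ => by split_ifs <;> positivity)).1 h
          refine Finset.sum_eq_zero fun i hi => ?_
          have h2 := this i hi
          split_ifs with h3
          · simp [h3] at h2; simp [h2]
          · rfl
        have hr : rad (fl ω j) = - rad (ω j) := by
          simp only [fl, Function.update_self, rad]
          cases ω j <;> simp
        rw [hX1, hT1, hX1, hT1, hX, hT, hvfl ω n le_rfl, hr]
        have := hU (X n ω) (T n ω) (v n ω) hTn hz
        cases h : ω j
        · simp only [rad]; simp only [Bool.false_eq_true, if_false]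
          ring_nf at this ⊢; linarith
        · simp only [rad]; simp only [if_true]
          ring_nf at this ⊢; linarith
      have := Finset.sum_le_sum fun ω (_ : ω ∈ Finset.univ) => hpt ω
      rw [Finset.sum_add_distrib, hsum, ← Finset.mul_sum] at this
      have := ih hn'.le
      linarith
  have := key N le_rfl
  simpa [X, T] using this

lemma sq_le_avg {N : ℕ} (a : Fin N → ℝ) :
    (2 : ℝ) ^ N * ∑ n, (a n) ^ 2 ≤ ∑ ω : Fin N → Bool, (∑ n, rad (ω n) * a n) ^ 2 := by
  have h := bellman (N := N) (fun m _ => if h : m < N then a ⟨m, h⟩ else 0)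
    (fun _ _ _ _ => rfl) (fun x t => t - x ^ 2) (fun x t w _ _ => by nlinarith) (by simp)
  simp only [Fin.is_lt, dite_true, Fin.eta, Finset.sum_sub_distrib, Finset.sum_const] at h
  simp at h
  linarith

lemma eLp_fin {Ω E : Type*} [Fintype Ω] [MeasurableSpace Ω] [MeasurableSingletonClass Ω]
    [NormedAddCommGroup E] (μ : Measure Ω) (w : ℝ) (hw : 0 ≤ w)
    (hμ : ∀ z, μ {z} = ENNReal.ofReal w) (f : Ω → E) :
    eLpNorm f 2 μ = ENNReal.ofReal (Real.sqrt (w * ∑ z, ‖f z‖ ^ 2)) := by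
  rw [eLpNorm_eq_lintegral_rpow_enorm_toReal (by norm_num) (by norm_num), lintegral_fintype,
    Real.sqrt_eq_rpow, ← ENNReal.ofReal_rpow_of_nonneg (by positivity) (by norm_num)]
  simp only [ENNReal.toReal_ofNat]
  congr 1
  rw [Finset.mul_sum, ENNReal.ofReal_sum_of_nonneg (fun _ _ => by positivity)]
  refine Finset.sum_congr rfl fun z _ => ?_
  rw [hμ, mul_comm, ENNReal.ofReal_mul hw, ENNReal.ofReal_pow (norm_nonneg _), ofReal_norm]
  norm_num

lemma bern_singleton (N : ℕ) (ω : Fin N → Bool) : bern N {ω} = ENNReal.ofReal ((1 / 2) ^ N) := by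
  have h : ∀ b : Bool, unifBool {b} = ENNReal.ofReal (1 / 2) := by
    have : (2 : ℝ≥0∞)⁻¹ = ENNReal.ofReal (1 / 2) := by
      rw [one_div, ENNReal.ofReal_inv_of_pos (by norm_num)]; norm_num
    intro b
    rw [← this]
    cases b <;> simp [unifBool]
  unfold bern
  have : ∀ b : Bool, SigmaFinite unifBool := fun _ => inferInstance
  rw [Measure.pi_singleton]
  simp only [h, Finset.prod_const, Finset.card_univ, Fintype.card_fin]
  rw [ENNReal.ofReal_pow (by norm_num)]

lemma coord_le (f : C₀(ℕ, ℝ)) (k : ℕ) : |f k| ≤ ‖f‖ := by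
  rw [← ZeroAtInftyContinuousMap.norm_toBCF_eq_norm]
  exact f.toBCF.norm_coe_le_norm k

lemma exists_coord (f : C₀(ℕ, ℝ)) : ∃ k, ‖f‖ ≤ 2 * |f k| := by
  by_contra! h
  have h2 : ‖f‖ ≤ ‖f‖ / 2 := by
    conv_lhs => rw [← ZeroAtInftyContinuousMap.norm_toBCF_eq_norm]
    refine (BoundedContinuousFunction.norm_le (by positivity)).2 fun k => ?_
    have := h k
    change |f k| ≤ _
    linarith
  have := h 0
  have := abs_nonneg (f 0)
  linarith

lemma pointwise (F S σ : ℝ) (k : ℕ) (hS : 0 ≤ S) (hSσ : S ≤ σ) (h0 : S = 0 → F = 0) :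
    (F / Real.sqrt (1 + Real.log (k + 1))) ^ 2 ≤
      16 * σ + 4 * (1 / ((k : ℝ) + 1) ^ 2) * (S * Real.exp (F ^ 2 / (4 * S))) := by
  have hl : 0 ≤ Real.log ((k : ℝ) + 1) := Real.log_nonneg (by linarith [Nat.cast_nonneg (α := ℝ) k])
  have hk : (0 : ℝ) < (k : ℝ) + 1 := by positivity
  rw [div_pow, Real.sq_sqrt (by linarith)]
  set A := 1 + Real.log ((k : ℝ) + 1) with hA
  have hA1 : 1 ≤ A := by linarith
  rcases hS.eq_or_lt with h | h
  · rw [h0 h.symm]; simp; rw [← h]; simp; linarith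
  set L := F ^ 2 / (4 * S) with hL
  have hF : F ^ 2 = 4 * S * L := by rw [hL]; field_simp
  have hL0 : 0 ≤ L := by positivity
  have hR : 0 ≤ 4 * (1 / ((k : ℝ) + 1) ^ 2) * (S * Real.exp L) := by positivity
  by_cases hc : L ≤ 4 * A
  · have : F ^ 2 / A ≤ 16 * S := by
      rw [div_le_iff₀ (by linarith), hF]; nlinarith
    linarith
  · push Not at hc
    have h1 : F ^ 2 / A ≤ F ^ 2 := div_le_self (sq_nonneg _) hA1
    have h2 : L ≤ Real.exp (L / 2) := by
      have := Real.quadratic_le_exp_of_nonneg (show 0 ≤ L / 2 by linarith)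
      nlinarith [sq_nonneg (L / 2 - 1)]
    have h3 : Real.exp (L / 2) ≤ 1 / ((k : ℝ) + 1) ^ 2 * Real.exp L := by
      have : ((k : ℝ) + 1) ^ 2 ≤ Real.exp (L / 2) := by
        calc ((k : ℝ) + 1) ^ 2 = Real.exp (2 * Real.log ((k : ℝ) + 1)) := by
              rw [mul_comm, Real.exp_mul, Real.exp_log hk]; norm_num
          _ ≤ _ := Real.exp_le_exp.2 (by linarith)
      have e : Real.exp L = Real.exp (L / 2) * Real.exp (L / 2) := by
        rw [← Real.exp_add]; congr 1; ring
      rw [one_div, inv_mul_eq_div, le_div_iff₀ (by positivity), e]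
      gcongr
    have : 4 * S * L ≤ 4 * S * (1 / ((k : ℝ) + 1) ^ 2 * Real.exp L) := by
      have := h2.trans h3
      gcongr
    have e : 4 * S * (1 / ((k : ℝ) + 1) ^ 2 * Real.exp L) =
      4 * (1 / ((k : ℝ) + 1) ^ 2) * (S * Real.exp L) := by ring
    linarith

lemma sum_inv_sq (K : ℕ) : ∑ k ∈ Finset.range K, 1 / ((k : ℝ) + 1) ^ 2 ≤ 2 := by
  have h : ∀ K : ℕ, ∑ k ∈ Finset.range (K + 1), 1 / ((k : ℝ) + 1) ^ 2 ≤ 2 - 1 / ((K : ℝ) + 1) := by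
    intro K
    induction K with
    | zero => norm_num
    | succ n ih =>
      rw [Finset.sum_range_succ]
      push_cast
      have h1 : 1 / ((n : ℝ) + 1 + 1) ^ 2 ≤ 1 / ((n : ℝ) + 1) - 1 / ((n : ℝ) + 1 + 1) := by
        have : 1 / ((n : ℝ) + 1) - 1 / ((n : ℝ) + 1 + 1) =
            1 / (((n : ℝ) + 1) * (n + 1 + 1)) := by
          field_simp; ring
        rw [this]
        apply one_div_le_one_div_of_le (by positivity)
        nlinarith [Nat.cast_nonneg (α := ℝ) n]
      linarith
  cases K with
  | zero => norm_num
  | succ n =>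
    have := h n
    have : 0 ≤ 1 / ((n : ℝ) + 1) := by positivity
    linarith

lemma sum_apply_c0 {ι : Type*} (s : Finset ι) (g : ι → C₀(ℕ, ℝ)) (k : ℕ) :
    (∑ i ∈ s, g i) k = ∑ i ∈ s, g i k := by
  classical
  induction s using Finset.induction_on with
  | empty => simp
  | insert a s ha ih => rw [Finset.sum_insert ha, Finset.sum_insert ha, ← ih]; rfl

lemma main_real {N : ℕ} (v : ℕ → (Fin N → Bool) → C₀(ℕ, ℝ)) (hv : DyadicAdapted v) :
    (2 : ℝ) ^ N * ∑ ω, ‖∑ n : Fin N, rad (ω n) • Dlog (v (n : ℕ) ω)‖ ^ 2 ≤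
      100 ^ 2 * ∑ ω, ∑ ω' : Fin N → Bool, ‖∑ n : Fin N, rad (ω' n) • v (n : ℕ) ω‖ ^ 2 := by
  set f : (Fin N → Bool) → C₀(ℕ, ℝ) := fun ω => ∑ n : Fin N, rad (ω n) • Dlog (v (n : ℕ) ω)
    with hf
  set σ : (Fin N → Bool) → ℝ := fun ω => (1 / 2 ^ N) *
    ∑ ω' : Fin N → Bool, ‖∑ n : Fin N, rad (ω' n) • v (n : ℕ) ω‖ ^ 2 with hσ
  let F : ℕ → (Fin N → Bool) → ℝ := fun k ω => ∑ n : Fin N, rad (ω n) * v n ω k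
  let S : ℕ → (Fin N → Bool) → ℝ := fun k ω => ∑ n : Fin N, (v n ω k) ^ 2
  have hS : ∀ k ω, 0 ≤ S k ω := fun k ω => Finset.sum_nonneg fun _ _ => sq_nonneg _
  have hSσ : ∀ k ω, S k ω ≤ σ ω := by
    intro k ω
    have h1 := sq_le_avg (fun n : Fin N => v n ω k)
    have h2 : ∑ ω' : Fin N → Bool, (∑ n : Fin N, rad (ω' n) * v n ω k) ^ 2 ≤
        ∑ ω' : Fin N → Bool, ‖∑ n : Fin N, rad (ω' n) • v (n : ℕ) ω‖ ^ 2 := by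
      refine Finset.sum_le_sum fun ω' _ => ?_
      have := coord_le (∑ n : Fin N, rad (ω' n) • v (n : ℕ) ω) k
      rw [sum_apply_c0] at this
      simp only [ZeroAtInftyContinuousMap.smul_apply, smul_eq_mul] at this
      exact sq_le_sq' (by linarith [neg_abs_le (∑ n : Fin N, rad (ω' n) * v n ω k)])
        ((le_abs_self _).trans this)
    rw [hσ]; simp only [S]
    rw [one_div, inv_mul_eq_div, le_div_iff₀ (by positivity)]
    linarith
  have h0 : ∀ k ω, S k ω = 0 → F k ω = 0 := by
    intro k ω h
    have := (Finset.sum_eq_zero_iff_of_nonneg (fun i _ => sq_nonneg _)).1 h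
    refine Finset.sum_eq_zero fun i hi => ?_
    have := this i hi
    simp at this; simp [this]
  have hfk : ∀ k ω, f ω k = F k ω / Real.sqrt (1 + Real.log (k + 1)) := by
    intro k ω
    rw [hf]; simp only [F]
    rw [sum_apply_c0, Finset.sum_div]
    refine Finset.sum_congr rfl fun n _ => ?_
    rw [ZeroAtInftyContinuousMap.smul_apply, smul_eq_mul, mul_div_assoc]; rfl
  let R : ℕ → (Fin N → Bool) → ℝ := fun k ω => S k ω * Real.exp (F k ω ^ 2 / (4 * S k ω))
  have hR0 : ∀ k ω, 0 ≤ R k ω := fun k ω => mul_nonneg (hS k ω) (Real.exp_pos _).le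
  have hR : ∀ k, ∑ ω, R k ω ≤ Real.exp (3 / 2) * ∑ ω, σ ω := by
    intro k
    have h := bellman (fun n ω => v n ω k) (fun n ω ω' h => by simp only [hv n ω ω' h])
      UU UU_step (by simp [UU])
    simp only [UU, Finset.sum_sub_distrib, ← Finset.mul_sum] at h
    have h2 : ∑ ω, S k ω ≤ ∑ ω, σ ω := Finset.sum_le_sum fun ω _ => hSσ k ω
    have h3 := mul_le_mul_of_nonneg_left h2 (Real.exp_pos (3 / 2)).le
    simp only [R, S, F] at *
    linarith
  choose kk hkk using fun ω => exists_coord (f ω)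
  let K := (Finset.univ.sup kk) + 1
  have hpt : ∀ ω, ‖f ω‖ ^ 2 ≤ 64 * σ ω +
      16 * ∑ k ∈ Finset.range K, 1 / ((k : ℝ) + 1) ^ 2 * R k ω := by
    intro ω
    have h1 := hkk ω
    have h2 := pointwise (F (kk ω) ω) (S (kk ω) ω) (σ ω) (kk ω) (hS _ _) (hSσ _ _) (h0 _ _)
    rw [← hfk] at h2
    have h3 : 1 / ((kk ω : ℝ) + 1) ^ 2 * R (kk ω) ω ≤
        ∑ k ∈ Finset.range K, 1 / ((k : ℝ) + 1) ^ 2 * R k ω := by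
      refine Finset.single_le_sum (f := fun k : ℕ => 1 / ((k : ℝ) + 1) ^ 2 * R k ω)
        (fun k _ => mul_nonneg (by positivity) (hR0 k ω)) ?_
      exact Finset.mem_range.2 (Nat.lt_succ_of_le (Finset.le_sup (Finset.mem_univ ω)))
    have h4 : ‖f ω‖ ^ 2 ≤ 4 * (f ω (kk ω)) ^ 2 := by
      have := pow_le_pow_left₀ (norm_nonneg _) h1 2
      rw [mul_pow, sq_abs] at this
      linarith
    simp only [R] at h3 ⊢
    linarith
  have hσ0 : 0 ≤ ∑ ω, σ ω := Finset.sum_nonneg fun ω _ => (hS 0 ω).trans (hSσ 0 ω)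
  have hfin : ∑ ω, ‖f ω‖ ^ 2 ≤ (64 + 32 * Real.exp (3 / 2)) * ∑ ω, σ ω := by
    have h1 := Finset.sum_le_sum fun ω (_ : ω ∈ Finset.univ) => hpt ω
    have h1' : ∑ ω, (64 * σ ω + 16 * ∑ k ∈ Finset.range K, 1 / ((k : ℝ) + 1) ^ 2 * R k ω) =
        64 * ∑ ω, σ ω + 16 * ∑ k ∈ Finset.range K, ∑ ω, 1 / ((k : ℝ) + 1) ^ 2 * R k ω := by
      rw [Finset.sum_add_distrib, Finset.mul_sum Finset.univ σ,
        Finset.sum_comm (s := Finset.range K), Finset.mul_sum Finset.univ]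
    rw [h1'] at h1
    have h2 : ∑ k ∈ Finset.range K, ∑ ω, 1 / ((k : ℝ) + 1) ^ 2 * R k ω ≤
        ∑ k ∈ Finset.range K, 1 / ((k : ℝ) + 1) ^ 2 * (Real.exp (3 / 2) * ∑ ω, σ ω) := by
      refine Finset.sum_le_sum fun k _ => ?_
      rw [← Finset.mul_sum]
      exact mul_le_mul_of_nonneg_left (hR k) (by positivity)
    rw [← Finset.sum_mul] at h2
    have h3 := mul_le_mul_of_nonneg_right (sum_inv_sq K)
      (mul_nonneg (Real.exp_pos (3 / 2)).le hσ0)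
    linarith
  have hexp : Real.exp (3 / 2) ≤ 9 := by
    calc Real.exp (3 / 2) ≤ Real.exp 2 := Real.exp_le_exp.2 (by norm_num)
      _ = Real.exp 1 * Real.exp 1 := by rw [← Real.exp_add]; norm_num
      _ ≤ 9 := by nlinarith [Real.exp_one_lt_d9, Real.exp_pos 1]
  have hfin2 : ∑ ω, ‖f ω‖ ^ 2 ≤ 100 ^ 2 * ∑ ω, σ ω :=
    hfin.trans (mul_le_mul_of_nonneg_right (by linarith) hσ0)
  have hσs : (2 : ℝ) ^ N * ∑ ω, σ ω =
      ∑ ω, ∑ ω' : Fin N → Bool, ‖∑ n : Fin N, rad (ω' n) • v (n : ℕ) ω‖ ^ 2 := by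
    rw [hσ]; simp only []
    rw [← Finset.mul_sum, ← mul_assoc]
    field_simp
  rw [← hσs]
  have := mul_le_mul_of_nonneg_left hfin2 (show (0 : ℝ) ≤ 2 ^ N by positivity)
  linarith

/-- Theorem: `D₂(D_{√log}) < ∞`, i.e. the diagonal operator `D_{√log} : c₀ → c₀`
satisfies an upper decoupling inequality for dyadic martingales in `L²`. -/
theorem dyadic_decoupling_Dlog_c0 :
    ∃ c : ℝ, 0 < c ∧
      ∀ N : ℕ, 2 ≤ N → ∀ v : ℕ → (Fin N → Bool) → C₀(ℕ, ℝ), DyadicAdapted v →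
        eLpNorm (fun ω => ∑ n : Fin N, rad (ω n) • Dlog (v (n : ℕ) ω)) 2 (bern N) ≤
          ENNReal.ofReal c *
            eLpNorm (fun z : (Fin N → Bool) × (Fin N → Bool) =>
              ∑ n : Fin N, rad (z.2 n) • v (n : ℕ) z.1) 2 ((bern N).prod (bern N)) := by
  refine ⟨100, by norm_num, fun N _ v hv => ?_⟩
  rw [eLp_fin (bern N) ((1 / 2) ^ N) (by positivity) (bern_singleton N),
    eLp_fin ((bern N).prod (bern N)) ((1 / 2) ^ N * (1 / 2) ^ N) (by positivity) ?_,
    ← ENNReal.ofReal_mul (by norm_num)]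
  · apply ENNReal.ofReal_le_ofReal
    rw [Fintype.sum_prod_type]
    have h := main_real v hv
    have e : (100 : ℝ) = Real.sqrt (100 ^ 2) := by rw [Real.sqrt_sq]; norm_num
    rw [e, ← Real.sqrt_mul (by positivity)]
    apply Real.sqrt_le_sqrt
    have h2 := mul_le_mul_of_nonneg_left h
      (show (0 : ℝ) ≤ (1 / 2) ^ N * (1 / 2) ^ N by positivity)
    have h3 : (1 / 2 : ℝ) ^ N * 2 ^ N = 1 := by rw [← mul_pow]; norm_num
    calc _ = ((1 / 2 : ℝ) ^ N * 2 ^ N) * ((1 / 2) ^ N *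
          ∑ ω, ‖∑ n : Fin N, rad (ω n) • Dlog (v (n : ℕ) ω)‖ ^ 2) := by rw [h3, one_mul]
      _ ≤ _ := by
        refine le_trans (le_of_eq ?_) (h2.trans (le_of_eq ?_)) <;> ring
  · rintro ⟨a, b⟩
    rw [← Set.singleton_prod_singleton, Measure.prod_prod, bern_singleton, bern_singleton,
      ← ENNReal.ofReal_mul (by positivity)]
end
end
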